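/- arXiv:2309.03662 — 9 statements merged into one kernel-verified Lean document; each statement's English description precedes it below -/
import Mathlib

section
/- Let f_1,…,f_k : [a,b] → ℝ be measurable and let {Λ_n = {λ_{1,n},…,λ_{d_n,n}}}_n be a sequence of finite multisets of real numbers with d_n → ∞. Assume (i) {Λ_n}_n ∼ diag(f_1,…,f_k), and (ii) for every n there exists a partition {Λ̃_{n,1},…,Λ̃_{n,k}} of Λ_n such that, for every j = 1,…,k, |Λ̃_{n,j}|/d_n → 1/k as n → ∞ and Λ̃_{n,j} ⊆ (ER(f_j))_{ε_n} for some ε_n → 0. Then for every n there exists a partition {Λ_{n,1},…,Λ_{n,k}} of Λ_n such that, for every j = 1,…,k: |Λ_{n,j}| = |Λ̃_{n,j}|; {Λ_{n,j}}_n ∼ f_j; and Λ_{n,j} ⊆ (ER(f_j))_{δ_n} for some δ_n → 0. -/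
open MeasureTheory Filter

/-- The essential range of `g : [a,b] → ℝ`. -/
def essentialRangeOn (a b : ℝ) (g : ℝ → ℝ) : Set ℝ :=
  {z : ℝ | ∀ ε : ℝ, 0 < ε → 0 < volume {x ∈ Set.Icc a b | |g x - z| < ε}}

/-- The `ε`-expansion `S_ε` of a set `S ⊆ ℝ`. -/
def expansion (S : Set ℝ) (ε : ℝ) : Set ℝ := {w : ℝ | ∃ z ∈ S, |w - z| < ε}

/-- Changing a single value of a map moves one unit from one fibre to another. -/
theorem card_fiber_update {ι V : Type*} [Fintype ι] [DecidableEq ι] [DecidableEq V]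
    (r : ι → V) (i : ι) (w j : V) :
    (Finset.univ.filter (fun x => Function.update r i w x = j)).card + (if j = r i then 1 else 0)
      = (Finset.univ.filter (fun x => r x = j)).card + (if j = w then 1 else 0) := by
  simp only [Finset.card_filter]
  rw [← Finset.add_sum_erase _ _ (Finset.mem_univ i),
    ← Finset.add_sum_erase _ (fun x => if r x = j then 1 else 0) (Finset.mem_univ i)]
  have h : ∑ x ∈ Finset.univ.erase i, (if Function.update r i w x = j then 1 else 0)
      = ∑ x ∈ Finset.univ.erase i, (if r x = j then 1 else 0) := by
    refine Finset.sum_congr rfl fun x hx => ?_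
    rw [Function.update_of_ne (Finset.ne_of_mem_erase hx)]
  rw [h, Function.update_self]
  simp only [eq_comm (a := j)]
  omega

theorem sum_card_fiber {ι V : Type*} [Fintype ι] [Fintype V] [DecidableEq V] (r : ι → V) :
    ∑ j, (Finset.univ.filter (fun x => r x = j)).card = Fintype.card ι :=
  (Finset.card_eq_sum_card_fiberwise (f := r) (s := Finset.univ) (t := Finset.univ)
    (fun _ _ => Finset.mem_coe.2 (Finset.mem_univ _))).symm

/-- If `u` is overfull for `r` with respect to `p`, then one unit can be moved from the fibre of `u`
to a deficient fibre by switching at most `|V|` values of `r` to those of `p`. -/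
theorem exists_augmentation {ι V : Type*} [Fintype ι] [Fintype V] [DecidableEq V] (r p : ι → V)
    (u : V) (hu : (Finset.univ.filter (fun i => p i = u)).card
      < (Finset.univ.filter (fun i => r i = u)).card) :
    ∃ v, (Finset.univ.filter (fun i => r i = v)).card
        < (Finset.univ.filter (fun i => p i = v)).card ∧
      ∃ r' : ι → V, (∀ i, r' i = r i ∨ r' i = p i) ∧
        (Finset.univ.filter (fun i => r' i ≠ r i)).card ≤ Fintype.card V ∧
        ∀ j, (Finset.univ.filter (fun i => r' i = j)).card + (if j = u then 1 else 0)
          = (Finset.univ.filter (fun i => r i = j)).card + (if j = v then 1 else 0) := by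
  classical
  let Reach : Finset V → Prop := fun S => u ∈ S ∧ ∀ v ∈ S, ∃ r' : ι → V,
    (∀ i, r' i = r i ∨ (r' i = p i ∧ p i ∈ S)) ∧
    (Finset.univ.filter (fun i => r' i ≠ r i)).card + 1 ≤ S.card ∧
    ∀ j, (Finset.univ.filter (fun i => r' i = j)).card + (if j = u then 1 else 0)
      = (Finset.univ.filter (fun i => r i = j)).card + (if j = v then 1 else 0)
  have h0 : Reach {u} := by
    refine ⟨Finset.mem_singleton_self u, fun v hv => ⟨r, fun i => Or.inl rfl, by simp, ?_⟩⟩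
    rw [Finset.mem_singleton.1 hv]
    exact fun j => rfl
  obtain ⟨S, hS, hmax⟩ := (Finset.univ.filter Reach).exists_max_image Finset.card
    ⟨{u}, by simpa using h0⟩
  obtain ⟨huS, hS⟩ : Reach S := by simpa using hS
  by_cases hdef : ∃ v ∈ S, (Finset.univ.filter (fun i => r i = v)).card
      < (Finset.univ.filter (fun i => p i = v)).card
  · obtain ⟨v, hvS, hv⟩ := hdef
    obtain ⟨r', h1, h2, h3⟩ := hS v hvS
    refine ⟨v, hv, r', fun i => (h1 i).imp_right And.left, ?_, h3⟩
    have := Finset.card_le_univ S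
    omega
  exfalso
  push Not at hdef
  by_cases hout : ∃ i, r i ∈ S ∧ p i ∉ S
  · obtain ⟨i, hri, hpi⟩ := hout
    obtain ⟨r', h1, h2, h3⟩ := hS (r i) hri
    have hr'i : r' i = r i := (h1 i).resolve_right fun h => hpi h.2
    have hnew : Reach (insert (p i) S) := by
      refine ⟨Finset.mem_insert_of_mem huS, fun v hv => ?_⟩
      rcases Finset.mem_insert.1 hv with rfl | hv
      · refine ⟨Function.update r' i (p i), fun x => ?_, ?_, fun j => ?_⟩
        · by_cases hx : x = i
          · subst hx
            exact Or.inr ⟨Function.update_self .., Finset.mem_insert_self _ _⟩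
          · rw [Function.update_of_ne hx]
            exact (h1 x).imp_right fun h => ⟨h.1, Finset.mem_insert_of_mem h.2⟩
        · rw [Finset.card_insert_of_notMem hpi]
          have hsub : (Finset.univ.filter (fun x => Function.update r' i (p i) x ≠ r x))
              ⊆ insert i (Finset.univ.filter (fun x => r' x ≠ r x)) := by
            intro x hx
            by_cases hxi : x = i
            · simp [hxi]
            · simpa [hxi, Function.update_of_ne hxi] using hx
          have := (Finset.card_le_card hsub).trans (Finset.card_insert_le _ _)
          omega
        · have hupd := card_fiber_update r' i (p i) j
          have := h3 j
          rw [hr'i] at hupd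
          omega
      · obtain ⟨r'', h1, h2, h3⟩ := hS v hv
        refine ⟨r'', fun x => (h1 x).imp_right fun h => ⟨h.1, Finset.mem_insert_of_mem h.2⟩, ?_, h3⟩
        rw [Finset.card_insert_of_notMem hpi]
        omega
    have := hmax _ (by simpa using hnew)
    rw [Finset.card_insert_of_notMem hpi] at this
    omega
  · push Not at hout
    have hr : ∑ j ∈ S, (Finset.univ.filter (fun i => r i = j)).card
        = (Finset.univ.filter (fun i => r i ∈ S)).card := by
      rw [Finset.card_eq_sum_card_fiberwise (f := r) (t := S) (fun x hx => by simpa using hx)]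
      refine Finset.sum_congr rfl fun j hj => ?_
      congr 1
      ext x
      simp only [Finset.mem_filter, Finset.mem_univ, true_and]
      exact ⟨fun h => ⟨h ▸ hj, h⟩, And.right⟩
    have hp : ∑ j ∈ S, (Finset.univ.filter (fun i => p i = j)).card
        = (Finset.univ.filter (fun i => p i ∈ S)).card := by
      rw [Finset.card_eq_sum_card_fiberwise (f := p) (t := S) (fun x hx => by simpa using hx)]
      refine Finset.sum_congr rfl fun j hj => ?_
      congr 1
      ext x
      simp only [Finset.mem_filter, Finset.mem_univ, true_and]
      exact ⟨fun h => ⟨h ▸ hj, h⟩, And.right⟩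
    have hlt := Finset.sum_lt_sum hdef ⟨u, huS, hu⟩
    rw [hr, hp] at hlt
    refine absurd (Finset.card_le_card ?_) hlt.not_ge
    intro x hx
    simp only [Finset.mem_filter, Finset.mem_univ, true_and] at hx ⊢
    exact hout x hx

/-- A map `r` can be given the fibre sizes of `p` by switching to the values of `p` at a number of
points controlled by the total deficiency of `r`. -/
theorem exists_rebalancing {ι V : Type*} [Fintype ι] [Fintype V] [DecidableEq V] (p : ι → V)
    (T : ℕ) : ∀ r : ι → V,
    ∑ j, ((Finset.univ.filter (fun i => p i = j)).card
      - (Finset.univ.filter (fun i => r i = j)).card) ≤ T →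
    ∃ q : ι → V, (∀ i, q i = r i ∨ q i = p i) ∧
      (Finset.univ.filter (fun i => q i ≠ r i)).card ≤ Fintype.card V * T ∧
      ∀ j, (Finset.univ.filter (fun i => q i = j)).card
        = (Finset.univ.filter (fun i => p i = j)).card := by
  classical
  induction T with
  | zero =>
    intro r hr
    refine ⟨r, fun i => Or.inl rfl, by simp, ?_⟩
    have hle : ∀ j ∈ Finset.univ, (Finset.univ.filter (fun i => p i = j)).card
        ≤ (Finset.univ.filter (fun i => r i = j)).card := by
      intro j hj
      have := Finset.sum_eq_zero_iff.1 (Nat.le_zero.1 hr) j hj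
      omega
    intro j
    exact ((Finset.sum_eq_sum_iff_of_le hle).1
      ((sum_card_fiber p).trans (sum_card_fiber r).symm) j (Finset.mem_univ j)).symm
  | succ T ih =>
    intro r hr
    by_cases hover : ∃ u, (Finset.univ.filter (fun i => p i = u)).card
      < (Finset.univ.filter (fun i => r i = u)).card
    · obtain ⟨u, hu⟩ := hover
      obtain ⟨v, hv, r', h1, h2, h3⟩ := exists_augmentation r p u hu
      have hlt : ∑ j, ((Finset.univ.filter (fun i => p i = j)).card
          - (Finset.univ.filter (fun i => r' i = j)).card)
          < ∑ j, ((Finset.univ.filter (fun i => p i = j)).card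
          - (Finset.univ.filter (fun i => r i = j)).card) := by
        refine Finset.sum_lt_sum (fun j _ => ?_) ⟨v, Finset.mem_univ v, ?_⟩
        · have := h3 j
          by_cases hj : j = u
          · subst hj
            simp only [if_true] at this
            omega
          · simp only [hj, if_false] at this
            omega
        · have := h3 v
          have hvu : v ≠ u := by
            rintro rfl
            omega
          simp only [hvu, if_true, if_false] at this
          omega
      obtain ⟨q, hq1, hq2, hq3⟩ := ih r' (by omega)
      refine ⟨q, fun i => ?_, ?_, hq3⟩
      · rcases hq1 i with h | h
        · rw [h]
          exact h1 i
        · exact Or.inr h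
      · have hsub : (Finset.univ.filter (fun i => q i ≠ r i))
            ⊆ (Finset.univ.filter (fun i => q i ≠ r' i))
              ∪ (Finset.univ.filter (fun i => r' i ≠ r i)) := by
          intro x hx
          simp only [Finset.mem_filter, Finset.mem_univ, true_and, Finset.mem_union] at hx ⊢
          by_contra! h
          exact hx (h.1.trans h.2)
        have := (Finset.card_le_card hsub).trans (Finset.card_union_le _ _)
        rw [Nat.mul_succ]
        omega
    · push Not at hover
      refine ⟨r, fun i => Or.inl rfl, by simp, fun j => ?_⟩
      exact (Finset.sum_eq_sum_iff_of_le fun j _ => hover j).1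
        ((sum_card_fiber r).trans (sum_card_fiber p).symm) j (Finset.mem_univ j)

/-- Pairwise disjoint prescribed pieces `A j` can be completed to a partition with the fibre sizes
of `p` that agrees with `p` off the pieces and loses only few elements of each piece. -/
theorem exists_partition_of_disjoint {ι V : Type*} [Fintype ι] [Fintype V] [DecidableEq ι]
    [DecidableEq V] (p : ι → V) (A : V → Finset ι)
    (hA : ∀ i j j', i ∈ A j → i ∈ A j' → j = j') :
    ∃ q : ι → V, (∀ i, q i = p i ∨ i ∈ A (q i)) ∧
      (∀ j, (A j \ Finset.univ.filter (fun i => q i = j)).card ≤ Fintype.card V *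
        ∑ j, ((Finset.univ.filter (fun i => p i = j)).card - (A j).card)) ∧
      ∀ j, (Finset.univ.filter (fun i => q i = j)).card
        = (Finset.univ.filter (fun i => p i = j)).card := by
  classical
  let r : ι → V := fun i => if h : ∃ j, i ∈ A j then h.choose else p i
  have hrA : ∀ i j, i ∈ A j → r i = j := by
    intro i j hij
    have h : ∃ j, i ∈ A j := ⟨j, hij⟩
    simp only [r, dif_pos h]
    exact hA i _ _ h.choose_spec hij
  have hr : ∀ i, r i = p i ∨ i ∈ A (r i) := by
    intro i
    by_cases h : ∃ j, i ∈ A j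
    · obtain ⟨j, hj⟩ := h
      rw [hrA i j hj]
      exact Or.inr hj
    · exact Or.inl (by simp only [r, dif_neg h])
  obtain ⟨q, h1, h2, h3⟩ := exists_rebalancing p _ r le_rfl
  refine ⟨q, fun i => ?_, fun j => ?_, h3⟩
  · rcases h1 i with h | h
    · rw [h]
      exact hr i
    · exact Or.inl h
  · refine (Finset.card_le_card ?_).trans (h2.trans (Nat.mul_le_mul_left _
      (Finset.sum_le_sum fun j _ => Nat.sub_le_sub_left (Finset.card_le_card ?_) _)))
    · intro x hx
      simp only [Finset.mem_sdiff, Finset.mem_filter, Finset.mem_univ, true_and] at hx ⊢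
      rw [hrA x j hx.1]
      exact hx.2
    · intro x hx
      simpa using hrA x j hx

theorem exists_disjoint_subsets_card_eq {ι V : Type*} [Fintype V] [DecidableEq ι] (S : Finset ι)
    (n : V → ℕ) (hn : ∑ j, n j ≤ S.card) :
    ∃ B : V → Finset ι, (∀ j, B j ⊆ S) ∧ (∀ i j j', i ∈ B j → i ∈ B j' → j = j') ∧
      ∀ j, (B j).card = n j := by
  obtain ⟨e⟩ := Function.Embedding.nonempty_of_card_le (α := Σ j, Fin (n j)) (β := S)
    (by simpa using hn)
  refine ⟨fun j => Finset.univ.image fun x : Fin (n j) => (e ⟨j, x⟩ : ι), ?_, ?_, ?_⟩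
  · intro j i hi
    obtain ⟨x, -, rfl⟩ := Finset.mem_image.1 hi
    exact (e ⟨j, x⟩).2
  · intro i j j' hi hi'
    obtain ⟨x, -, rfl⟩ := Finset.mem_image.1 hi
    obtain ⟨y, -, hy⟩ := Finset.mem_image.1 hi'
    exact congrArg Sigma.fst (e.injective (Subtype.ext hy)).symm
  · intro j
    rw [Finset.card_image_of_injective _ fun x y hxy => ?_, Finset.card_univ, Fintype.card_fin]
    simpa using e.injective (Subtype.ext hxy)

/-- Finitely many probability measures on `ℝ` are simultaneously carried, up to mass `η`, by finitely
many disjoint intervals of common length at most `η`. -/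
theorem exists_disjoint_balls {V : Type*} [Finite V] (μ : V → Measure ℝ)
    [∀ j, IsProbabilityMeasure (μ j)] {η : ℝ} (hη : 0 < η) :
    ∃ (s : Finset ℤ) (c : ℤ → ℝ) (ρ : ℝ), 0 < ρ ∧ 2 * ρ ≤ η ∧
      Pairwise (Function.onFun Disjoint fun l => Metric.ball (c l) ρ) ∧
      ∀ j, 1 - η ≤ ∑ l ∈ s, (μ j).real (Metric.ball (c l) ρ) := by
  have hmeas : Measurable fun x : ℝ => Int.fract (x / η) :=
    measurable_fract.comp (measurable_id.div_const η)
  have hcount : (⋃ j, {t : ℝ | 0 < μ j {x | Int.fract (x / η) = t}}).Countable :=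
    Set.countable_iUnion fun j => Measure.countable_meas_level_set_pos hmeas
  obtain ⟨t, ht, ht0, ht1⟩ := (hcount.dense_compl ℝ).exists_between (zero_lt_one (α := ℝ))
  have hnull : ∀ j, μ j {x | Int.fract (x / η) = t} = 0 := by
    intro j
    by_contra h
    exact ht (Set.mem_iUnion.2 ⟨j, pos_iff_ne_zero.2 h⟩)
  let c : ℤ → ℝ := fun l => η * (l + t) + η / 2
  have hmem : ∀ (l : ℤ) (x : ℝ),
      x ∈ Metric.ball (c l) (η / 2) ↔ (l : ℝ) < x / η - t ∧ x / η - t < l + 1 := by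
    intro l x
    rw [Metric.mem_ball, Real.dist_eq, abs_lt, lt_sub_iff_add_lt (a := (l : ℝ)), lt_div_iff₀ hη,
      sub_lt_iff_lt_add (a := x / η), div_lt_iff₀ hη]
    simp only [c]
    constructor <;> rintro ⟨h1, h2⟩ <;> constructor <;> nlinarith
  have hdisj : Pairwise (Function.onFun Disjoint fun l => Metric.ball (c l) (η / 2)) := by
    intro l l' hl
    refine Set.disjoint_left.2 fun x hx hx' => hl ?_
    rw [hmem] at hx hx'
    have h1 : (l : ℝ) < l' + 1 := hx.1.trans hx'.2
    have h2 : (l' : ℝ) < l + 1 := hx'.1.trans hx.2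
    norm_cast at h1 h2
    omega
  have hcover : (⋃ l, Metric.ball (c l) (η / 2))ᶜ ⊆ {x | Int.fract (x / η) = t} := by
    intro x hx
    by_contra hne
    refine hx (Set.mem_iUnion.2 ⟨⌊x / η - t⌋, (hmem _ _).2 ⟨?_, Int.lt_floor_add_one _⟩⟩)
    refine lt_of_le_of_ne (Int.floor_le _) fun h => hne ?_
    rw [Set.mem_ofPred_eq, Int.fract_eq_iff]
    exact ⟨ht0.le, ht1, ⌊x / η - t⌋, by rw [h]⟩
  have hsum : ∀ j, HasSum (fun l => (μ j).real (Metric.ball (c l) (η / 2))) 1 := by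
    intro j
    have h1 : μ j (⋃ l, Metric.ball (c l) (η / 2)) = 1 := by
      rw [← prob_compl_eq_zero_iff (MeasurableSet.iUnion fun l => measurableSet_ball)]
      exact measure_mono_null hcover (hnull j)
    rw [measure_iUnion hdisj fun l => measurableSet_ball] at h1
    have h2 := ENNReal.hasSum_toReal (f := fun l => μ j (Metric.ball (c l) (η / 2)))
      (by rw [h1]; exact ENNReal.one_ne_top)
    rwa [← ENNReal.tsum_toReal_eq fun l => measure_ne_top _ _, h1, ENNReal.toReal_one] at h2
  have hev : ∀ᶠ s : Finset ℤ in atTop, ∀ j,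
      1 - η < ∑ l ∈ s, (μ j).real (Metric.ball (c l) (η / 2)) :=
    eventually_all.2 fun j => (hsum j).eventually (lt_mem_nhds (by linarith))
  obtain ⟨s, hs⟩ := hev.exists
  exact ⟨s, c, η / 2, by positivity, by linarith, hdisj, fun j => (hs j).le⟩

/-- Lower semicontinuity on balls of the mass of empirical measures. -/
theorem eventually_le_card_ball {V : Type*} [Fintype V] (μ : V → Measure ℝ)
    [∀ j, IsProbabilityMeasure (μ j)] (K : ℝ) (dn : ℕ → ℕ) (lam : ∀ n, Fin (dn n) → ℝ)
    (h : ∀ F : ℝ → ℝ, Continuous F → HasCompactSupport F →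
      Tendsto (fun n => (dn n : ℝ)⁻¹ * ∑ i, F (lam n i)) atTop
        (nhds ((∑ j, ∫ x, F x ∂(μ j)) / K)))
    (x ρ c : ℝ) (hc : c < (∑ j, (μ j).real (Metric.ball x ρ)) / K) :
    ∀ᶠ n in atTop, c * dn n
      ≤ ((Finset.univ.filter (fun i => dist (lam n i) x < ρ)).card : ℝ) := by
  let G : ℕ → ℝ → ℝ := fun m y => min 1 (m * max 0 (ρ - |y - x|))
  have hGcont : ∀ m, Continuous (G m) := fun m => by fun_prop
  have hG0 : ∀ m y, 0 ≤ G m y := fun m y =>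
    le_min zero_le_one (mul_nonneg m.cast_nonneg (le_max_left _ _))
  have hG1 : ∀ m y, G m y ≤ 1 := fun m y => min_le_left _ _
  have hGout : ∀ m y, y ∉ Metric.ball x ρ → G m y = 0 := by
    intro m y hy
    rw [Metric.mem_ball, Real.dist_eq, not_lt] at hy
    simp only [G, max_eq_left (sub_nonpos.2 hy), mul_zero, min_eq_right zero_le_one]
  have hGsupp : ∀ m, HasCompactSupport (G m) := fun m =>
    HasCompactSupport.intro (isCompact_closedBall x ρ) fun y hy =>
      hGout m y fun hy' => hy (Metric.ball_subset_closedBall hy')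
  have hGlim : ∀ y, Tendsto (fun m => G m y) atTop
      (nhds ((Metric.ball x ρ).indicator (fun _ => (1 : ℝ)) y)) := by
    intro y
    by_cases hy : y ∈ Metric.ball x ρ
    · rw [Set.indicator_of_mem hy]
      rw [Metric.mem_ball, Real.dist_eq] at hy
      have hpos : 0 < max 0 (ρ - |y - x|) := lt_max_of_lt_right (sub_pos.2 hy)
      have ht : Tendsto (fun m : ℕ => (m : ℝ) * max 0 (ρ - |y - x|)) atTop atTop :=
        tendsto_natCast_atTop_atTop.atTop_mul_const hpos
      refine tendsto_const_nhds.congr' ?_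
      filter_upwards [ht.eventually_ge_atTop 1] with m hm
      exact (min_eq_left hm).symm
    · rw [Set.indicator_of_notMem hy]
      exact tendsto_const_nhds.congr fun m => (hGout m y hy).symm
  have hint : Tendsto (fun m => (∑ j, ∫ y, G m y ∂(μ j)) / K) atTop
      (nhds ((∑ j, (μ j).real (Metric.ball x ρ)) / K)) := by
    refine (tendsto_finsetSum _ fun j _ => ?_).div_const K
    rw [← integral_indicator_one measurableSet_ball]
    refine tendsto_integral_of_dominated_convergence (fun _ => (1 : ℝ))
      (fun m => (hGcont m).aestronglyMeasurable) (integrable_const _)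
      (fun m => Eventually.of_forall fun y => ?_) (Eventually.of_forall hGlim)
    rw [Real.norm_eq_abs, abs_of_nonneg (hG0 m y)]
    exact hG1 m y
  obtain ⟨m, hm⟩ := (hint.eventually (lt_mem_nhds hc)).exists
  filter_upwards [(h (G m) (hGcont m) (hGsupp m)).eventually (lt_mem_nhds hm)] with n hn
  rcases Nat.eq_zero_or_pos (dn n) with h0 | h0
  · have h0' : (dn n : ℝ) = 0 := by exact_mod_cast h0
    rw [h0', mul_zero]
    exact Nat.cast_nonneg _
  have hpos : (0 : ℝ) < dn n := by exact_mod_cast h0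
  have hle : ∑ i, G m (lam n i)
      ≤ ((Finset.univ.filter (fun i => dist (lam n i) x < ρ)).card : ℝ) := by
    rw [Finset.card_filter]
    push_cast
    refine Finset.sum_le_sum fun i _ => ?_
    split_ifs with hi
    · exact hG1 m _
    · exact (hGout m _ hi).le
  rw [inv_mul_eq_div, lt_div_iff₀ hpos] at hn
  exact hn.le.trans hle

/-- Quadrature error of a sum over `Q` that is close to a union of samples `B l` taken from small
cells `C l` in proportion to their mass. -/
theorem norm_sum_sub_integral_le {ι L : Type*} [DecidableEq ι] (μ : Measure ℝ)
    [IsProbabilityMeasure μ] (s : Finset L) (C : L → Set ℝ) (hC : ∀ l, MeasurableSet (C l))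
    (hdisj : Pairwise (Function.onFun Disjoint C)) (x : L → ℝ) (lam : ι → ℝ) (B : L → Finset ι)
    (hB : ∀ l, ∀ i ∈ B l, lam i ∈ C l) (Q : Finset ι)
    (hcard : ∀ l, ((B l).card : ℝ) ≤ Q.card * μ.real (C l))
    (F : ℝ → ℂ) (hF : Continuous F) (M ω : ℝ) (hM : ∀ y, ‖F y‖ ≤ M)
    (hω : ∀ l, ∀ y ∈ C l, ‖F y - F (x l)‖ ≤ ω) (hω0 : 0 ≤ ω) :
    ‖∑ i ∈ Q, F (lam i) - Q.card * ∫ y, F y ∂μ‖ ≤ 2 * ω * Q.card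
      + M * ((Q.card - (s.biUnion B).card) + Q.card * (1 - ∑ l ∈ s, μ.real (C l))
        + (s.biUnion B \ Q).card + (Q \ s.biUnion B).card) := by
  have hM0 : 0 ≤ M := (norm_nonneg _).trans (hM 0)
  have hFint : Integrable F μ :=
    Integrable.of_bound hF.aestronglyMeasurable M (Eventually.of_forall hM)
  have hBdisj : (s : Set L).PairwiseDisjoint B := by
    intro l _ l' _ hl
    refine Finset.disjoint_left.2 fun i hi hi' => ?_
    exact Set.disjoint_left.1 (hdisj hl) (hB l i hi) (hB l' i hi')
  have hsumle : ∑ l ∈ s, μ.real (C l) ≤ 1 := by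
    rw [← measureReal_biUnion_finset (fun l _ l' _ h => hdisj h) fun l _ => hC l]
    exact measureReal_le_one
  set A := s.biUnion B with hA
  have hcardA : (A.card : ℝ) = ∑ l ∈ s, ((B l).card : ℝ) := by
    rw [hA, Finset.card_biUnion hBdisj]
    push_cast
    rfl
  have hsplit : ∑ i ∈ Q, F (lam i) - ∑ i ∈ A, F (lam i)
      = ∑ i ∈ Q \ A, F (lam i) - ∑ i ∈ A \ Q, F (lam i) := Finset.sum_sdiff_sub_sum_sdiff.symm
  have hnorm : ∀ D : Finset ι, ‖∑ i ∈ D, F (lam i)‖ ≤ M * D.card := by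
    intro D
    refine (norm_sum_le_of_le D fun i _ => hM (lam i)).trans ?_
    rw [Finset.sum_const, nsmul_eq_mul, mul_comm]
  have hcell : ∀ l, ‖∑ i ∈ B l, F (lam i) - Q.card * ∫ y in C l, F y ∂μ‖
      ≤ 2 * ω * (Q.card * μ.real (C l)) + M * (Q.card * μ.real (C l) - (B l).card) := by
    intro l
    have h1 : ‖∑ i ∈ B l, (F (lam i) - F (x l))‖ ≤ ω * (B l).card := by
      refine (norm_sum_le_of_le _ fun i hi => hω l _ (hB l i hi)).trans ?_
      rw [Finset.sum_const, nsmul_eq_mul, mul_comm]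
    have h2 : ‖∫ y in C l, (F y - F (x l)) ∂μ‖ ≤ ω * μ.real (C l) :=
      norm_setIntegral_le_of_norm_le_const (measure_lt_top _ _) (hω l)
    have h3 : ‖((((B l).card : ℝ) - Q.card * μ.real (C l) : ℝ) : ℂ) * F (x l)‖
        ≤ M * (Q.card * μ.real (C l) - (B l).card) := by
      rw [norm_mul, Complex.norm_real, Real.norm_eq_abs, abs_of_nonpos (by linarith [hcard l]),
        mul_comm, neg_sub]
      exact mul_le_mul_of_nonneg_right (hM _) (by linarith [hcard l])
    have heq : ∑ i ∈ B l, F (lam i) - Q.card * ∫ y in C l, F y ∂μ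
        = ∑ i ∈ B l, (F (lam i) - F (x l)) - Q.card * ∫ y in C l, (F y - F (x l)) ∂μ
          + ((((B l).card : ℝ) - Q.card * μ.real (C l) : ℝ) : ℂ) * F (x l) := by
      rw [integral_sub hFint.integrableOn (integrable_const _), Finset.sum_sub_distrib,
        setIntegral_const, Finset.sum_const, nsmul_eq_mul, Complex.real_smul]
      push_cast
      ring
    rw [heq]
    have h4 : ‖(Q.card : ℂ) * ∫ y in C l, (F y - F (x l)) ∂μ‖ ≤ Q.card * (ω * μ.real (C l)) := by
      rw [norm_mul, Complex.norm_natCast]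
      exact mul_le_mul_of_nonneg_left h2 (Nat.cast_nonneg _)
    have h5 := mul_le_mul_of_nonneg_left (hcard l) hω0
    have h6 := norm_add_le (∑ i ∈ B l, (F (lam i) - F (x l))
      - Q.card * ∫ y in C l, (F y - F (x l)) ∂μ)
      (((((B l).card : ℝ) - Q.card * μ.real (C l) : ℝ) : ℂ) * F (x l))
    have h7 := norm_sub_le (∑ i ∈ B l, (F (lam i) - F (x l)))
      (Q.card * ∫ y in C l, (F y - F (x l)) ∂μ)
    linarith
  set U := ⋃ l ∈ s, C l with hU
  have hUmeas : MeasurableSet U := s.measurableSet_biUnion fun l _ => hC l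
  have hUint : ∫ y in U, F y ∂μ = ∑ l ∈ s, ∫ y in C l, F y ∂μ :=
    integral_biUnion_finset s (fun l _ => hC l) (fun l _ l' _ h => hdisj h)
      fun l _ => hFint.integrableOn
  have hUc : ‖∫ y in Uᶜ, F y ∂μ‖ ≤ M * (1 - ∑ l ∈ s, μ.real (C l)) := by
    refine (norm_setIntegral_le_of_norm_le_const (measure_lt_top _ _) fun y _ => hM y).trans ?_
    rw [probReal_compl_eq_one_sub hUmeas, hU,
      measureReal_biUnion_finset (fun l _ l' _ h => hdisj h) fun l _ => hC l]
  have hdecomp : ∑ i ∈ Q, F (lam i) - Q.card * ∫ y, F y ∂μ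
      = (∑ i ∈ Q \ A, F (lam i) - ∑ i ∈ A \ Q, F (lam i))
        + ∑ l ∈ s, (∑ i ∈ B l, F (lam i) - Q.card * ∫ y in C l, F y ∂μ)
        - Q.card * ∫ y in Uᶜ, F y ∂μ := by
    rw [← hsplit, ← integral_add_compl hUmeas hFint, hUint, Finset.sum_sub_distrib, hA,
      Finset.sum_biUnion hBdisj, ← Finset.mul_sum]
    ring
  have hcells := (norm_sum_le_of_le s fun l _ => hcell l)
  have hcells' : ∑ l ∈ s, (2 * ω * (Q.card * μ.real (C l))
        + M * (Q.card * μ.real (C l) - (B l).card))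
      = 2 * ω * (Q.card * ∑ l ∈ s, μ.real (C l))
        + M * (Q.card * ∑ l ∈ s, μ.real (C l) - A.card) := by
    rw [hcardA, Finset.sum_add_distrib, ← Finset.mul_sum, ← Finset.mul_sum, ← Finset.mul_sum,
      Finset.sum_sub_distrib, ← Finset.mul_sum]
  rw [hcells'] at hcells
  have hQ0 : (0 : ℝ) ≤ Q.card := Nat.cast_nonneg _
  have hUc' : ‖(Q.card : ℂ) * ∫ y in Uᶜ, F y ∂μ‖
      ≤ Q.card * (M * (1 - ∑ l ∈ s, μ.real (C l))) := by
    rw [norm_mul, Complex.norm_natCast]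
    exact mul_le_mul_of_nonneg_left hUc hQ0
  have hQm : (Q.card : ℝ) * ∑ l ∈ s, μ.real (C l) ≤ Q.card :=
    mul_le_of_le_one_right hQ0 hsumle
  have hωm := mul_le_mul_of_nonneg_left hQm (mul_nonneg zero_le_two hω0)
  have hMm := mul_le_mul_of_nonneg_left hQm hM0
  rw [hdecomp]
  have n1 := norm_sub_le ((∑ i ∈ Q \ A, F (lam i) - ∑ i ∈ A \ Q, F (lam i))
        + ∑ l ∈ s, (∑ i ∈ B l, F (lam i) - Q.card * ∫ y in C l, F y ∂μ))
        (Q.card * ∫ y in Uᶜ, F y ∂μ)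
  have n2 := norm_add_le (∑ i ∈ Q \ A, F (lam i) - ∑ i ∈ A \ Q, F (lam i))
    (∑ l ∈ s, (∑ i ∈ B l, F (lam i) - Q.card * ∫ y in C l, F y ∂μ))
  have n3 := norm_sub_le (∑ i ∈ Q \ A, F (lam i)) (∑ i ∈ A \ Q, F (lam i))
  linarith [hnorm (Q \ A), hnorm (A \ Q)]

/-- At every accuracy `η`, all sufficiently late multisets admit a partition with the fibre sizes of
`p` whose `j`-th class lies near `S j` and averages test functions almost like `μ j`. -/
theorem eventually_exists_good_partition {k : ℕ} (hk : 0 < k) (μ : Fin k → Measure ℝ)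
    [∀ j, IsProbabilityMeasure (μ j)] (S : Fin k → Set ℝ)
    (hS : ∀ j (C : Set ℝ), μ j C ≠ 0 → ∃ z ∈ C, z ∈ S j)
    (dn : ℕ → ℕ) (hd : Tendsto dn atTop atTop) (lam : ∀ n, Fin (dn n) → ℝ)
    (hdistr : ∀ F : ℝ → ℝ, Continuous F → HasCompactSupport F →
      Tendsto (fun n => (dn n : ℝ)⁻¹ * ∑ i, F (lam n i)) atTop
        (nhds ((∑ j, ∫ x, F x ∂(μ j)) / k)))
    (p : ∀ n, Fin (dn n) → Fin k) (ε : ℕ → ℝ) (hε : Tendsto ε atTop (nhds 0))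
    (hpcard : ∀ j : Fin k, Tendsto (fun n =>
        ((Finset.univ.filter (fun i => p n i = j)).card : ℝ) / (dn n : ℝ)) atTop
        (nhds (1 / (k : ℝ))))
    (hpmem : ∀ n i, lam n i ∈ expansion (S (p n i)) (ε n))
    {η : ℝ} (hη : 0 < η) (hη1 : η ≤ 1 / 2) :
    ∀ᶠ n in atTop, ∃ q : Fin (dn n) → Fin k,
      (∀ j, (Finset.univ.filter (fun i => q i = j)).card
        = (Finset.univ.filter (fun i => p n i = j)).card) ∧
      (∀ i, lam n i ∈ expansion (S (q i)) η) ∧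
      ∀ (j : Fin k) (F : ℝ → ℂ) (M ω : ℝ), Continuous F → (∀ y, ‖F y‖ ≤ M) → 0 ≤ ω →
        (∀ y z, |y - z| < η → ‖F y - F z‖ ≤ ω) →
        ‖((Finset.univ.filter (fun i => q i = j)).card : ℂ)⁻¹ *
            ∑ i ∈ Finset.univ.filter (fun i => q i = j), F (lam n i) - ∫ y, F y ∂(μ j)‖
          ≤ 2 * ω + M * ((17 + 16 * (k : ℝ) ^ 2) * η) := by
  classical
  obtain ⟨s, c, ρ, hρ, hρη, hdisj, hmass⟩ := exists_disjoint_balls μ hη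
  have hk' : (0 : ℝ) < k := by exact_mod_cast hk
  have hdR : Tendsto (fun n => (dn n : ℝ)) atTop atTop := tendsto_natCast_atTop_atTop.comp hd
  have hcells : ∀ᶠ n in atTop, ∀ l ∈ s,
      (1 - η) * ((∑ j, (μ j).real (Metric.ball (c l) ρ)) / k) * dn n
        ≤ ((Finset.univ.filter (fun i => dist (lam n i) (c l) < ρ)).card : ℝ) := by
    refine (Finset.eventually_all s).2 fun l _ => ?_
    have hm0 : 0 ≤ (∑ j, (μ j).real (Metric.ball (c l) ρ)) / (k : ℝ) :=
      div_nonneg (Finset.sum_nonneg fun j _ => measureReal_nonneg) hk'.le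
    rcases hm0.eq_or_lt with h0 | h0
    · refine Eventually.of_forall fun n => ?_
      rw [← h0]
      simp
    · exact eventually_le_card_ball μ k dn lam hdistr (c l) ρ _ (by nlinarith)
  have hlow : ∀ᶠ n in atTop, ∀ j,
      (1 - η) / k < ((Finset.univ.filter (fun i => p n i = j)).card : ℝ) / dn n :=
    eventually_all.2 fun j => (hpcard j).eventually (lt_mem_nhds (by gcongr; linarith))
  have hupp : ∀ᶠ n in atTop, ∀ j,
      ((Finset.univ.filter (fun i => p n i = j)).card : ℝ) / dn n < (1 + η) / k :=
    eventually_all.2 fun j => (hpcard j).eventually (gt_mem_nhds (by gcongr; linarith))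
  filter_upwards [hcells, hlow, hupp, hε.eventually (gt_mem_nhds hη),
    hdR.eventually_ge_atTop (s.card * k / η), hdR.eventually_gt_atTop 0]
    with n hcells hlow hupp hεn hdn hdn0
  set X : ℝ := dn n / k with hX
  have hX0 : 0 < X := div_pos hdn0 hk'
  have hsX : (s.card : ℝ) ≤ η * X := by
    rw [div_le_iff₀ hη] at hdn
    rw [hX, mul_div_assoc', le_div_iff₀ hk']
    linarith
  have hlow : ∀ j, (1 - η) * X ≤ ((Finset.univ.filter (fun i => p n i = j)).card : ℝ) := by
    intro j
    have := (lt_div_iff₀ hdn0).1 (hlow j)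
    rw [hX]
    exact this.le.trans' (le_of_eq (by ring))
  have hupp : ∀ j, ((Finset.univ.filter (fun i => p n i = j)).card : ℝ) ≤ (1 + η) * X := by
    intro j
    have := (div_lt_iff₀ hdn0).1 (hupp j)
    rw [hX]
    exact this.le.trans (le_of_eq (by ring))
  let m : ℤ → Fin k → ℕ := fun l j => ⌊(1 - η) * X * (μ j).real (Metric.ball (c l) ρ)⌋₊
  have h1η : 0 ≤ (1 - η) * X := mul_nonneg (by linarith) hX0.le
  have hmle : ∀ l j, (m l j : ℝ) ≤ (1 - η) * X * (μ j).real (Metric.ball (c l) ρ) :=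
    fun l j => Nat.floor_le (mul_nonneg h1η measureReal_nonneg)
  have hBex : ∀ l : ℤ, ∃ B : Fin k → Finset (Fin (dn n)),
      (∀ j, B j ⊆ Finset.univ.filter (fun i => dist (lam n i) (c l) < ρ)) ∧
      (∀ i j j', i ∈ B j → i ∈ B j' → j = j') ∧ ∀ j, (B j).card = if l ∈ s then m l j else 0 := by
    intro l
    refine exists_disjoint_subsets_card_eq _ _ ?_
    split_ifs with hl
    · have h1 : (∑ j, (m l j : ℝ)) ≤ _ := Finset.sum_le_sum fun j _ => hmle l j
      rw [← Finset.mul_sum] at h1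
      have h2 := hcells l hl
      have h3 : (1 - η) * ((∑ j, (μ j).real (Metric.ball (c l) ρ)) / k) * dn n
        = (1 - η) * X * ∑ j, (μ j).real (Metric.ball (c l) ρ) := by
        rw [hX]
        ring
      rw [h3] at h2
      exact_mod_cast h1.trans h2
    · simp
  choose B hBsub hBdisj hBcard using hBex
  have hBball : ∀ l j, ∀ i ∈ B l j, lam n i ∈ Metric.ball (c l) ρ := by
    intro l j i hi
    exact (Finset.mem_filter.1 (hBsub l j hi)).2
  have hBle : ∀ l j, ((B l j).card : ℝ) ≤ (1 - η) * X * (μ j).real (Metric.ball (c l) ρ) := by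
    intro l j
    rw [hBcard]
    split_ifs
    · exact hmle l j
    · rw [Nat.cast_zero]
      exact mul_nonneg h1η measureReal_nonneg
  let A : Fin k → Finset (Fin (dn n)) := fun j => s.biUnion fun l => B l j
  have hAdisj : ∀ i j j', i ∈ A j → i ∈ A j' → j = j' := by
    intro i j j' hi hi'
    obtain ⟨l, -, hl⟩ := Finset.mem_biUnion.1 hi
    obtain ⟨l', -, hl'⟩ := Finset.mem_biUnion.1 hi'
    have hll : l = l' := by
      by_contra hne
      exact Set.disjoint_left.1 (hdisj hne) (hBball l j i hl) (hBball l' j' i hl')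
    subst hll
    exact hBdisj l i j j' hl hl'
  have hAcard : ∀ j, (1 - 3 * η) * X ≤ ((A j).card : ℝ) := by
    intro j
    have hc : (A j).card = ∑ l ∈ s, m l j := by
      rw [Finset.card_biUnion]
      · exact Finset.sum_congr rfl fun l hl => by rw [hBcard, if_pos hl]
      · intro l _ l' _ hne
        refine Finset.disjoint_left.2 fun i hi hi' => ?_
        exact Set.disjoint_left.1 (hdisj hne) (hBball l j i hi) (hBball l' j i hi')
    have h1 : ∑ l ∈ s, ((1 - η) * X * (μ j).real (Metric.ball (c l) ρ) - 1)
        ≤ ∑ l ∈ s, (m l j : ℝ) :=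
      Finset.sum_le_sum fun l _ => (Nat.sub_one_lt_floor _).le
    rw [Finset.sum_sub_distrib, ← Finset.mul_sum, Finset.sum_const, nsmul_eq_mul, mul_one] at h1
    have h2 := mul_le_mul_of_nonneg_left (hmass j) h1η
    rw [hc]
    push_cast
    nlinarith [mul_nonneg hη.le (mul_nonneg hη.le hX0.le)]
  have hdef : ∀ j, ((Finset.univ.filter (fun i => p n i = j)).card : ℝ) - (A j).card
      ≤ 4 * η * X := fun j => by linarith [hupp j, hAcard j]
  obtain ⟨q, hq1, hq2, hq3⟩ := exists_partition_of_disjoint (p n) A hAdisj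
  have hT : ∀ j, ((A j \ Finset.univ.filter (fun i => q i = j)).card : ℝ)
      ≤ k * (k * (4 * η * X)) := by
    intro j
    have h1 : ((A j \ Finset.univ.filter (fun i => q i = j)).card : ℝ)
      ≤ k * ∑ j, (((Finset.univ.filter (fun i => p n i = j)).card - (A j).card : ℕ) : ℝ) := by
      have := hq2 j
      rw [Fintype.card_fin] at this
      exact_mod_cast this
    have h2 : ∑ j, (((Finset.univ.filter (fun i => p n i = j)).card - (A j).card : ℕ) : ℝ)
        ≤ ∑ j : Fin k, 4 * η * X := by
      refine Finset.sum_le_sum fun j _ => ?_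
      rcases le_total (A j).card (Finset.univ.filter (fun i => p n i = j)).card with hle | hle
      · rw [Nat.cast_sub hle]
        exact hdef j
      · rw [Nat.sub_eq_zero_of_le hle, Nat.cast_zero]
        positivity
    rw [Finset.sum_const, Finset.card_univ, Fintype.card_fin, nsmul_eq_mul] at h2
    exact h1.trans (mul_le_mul_of_nonneg_left h2 hk'.le)
  refine ⟨q, hq3, fun i => ?_, fun j F M ω hF hM hω0 hω => ?_⟩
  · rcases hq1 i with h | h
    · rw [h]
      obtain ⟨z, hz, hzi⟩ := hpmem n i
      exact ⟨z, hz, hzi.trans hεn⟩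
    · obtain ⟨l, -, hl⟩ := Finset.mem_biUnion.1 h
      have hne : μ (q i) (Metric.ball (c l) ρ) ≠ 0 := by
        intro h0
        have h1 := hBle l (q i)
        rw [measureReal_def, h0, ENNReal.toReal_zero, mul_zero] at h1
        have h2 : 0 < (B l (q i)).card := Finset.card_pos.2 ⟨i, hl⟩
        have h3 : (0 : ℝ) < (B l (q i)).card := by exact_mod_cast h2
        linarith
      obtain ⟨z, hz, hzS⟩ := hS (q i) _ hne
      refine ⟨z, hzS, ?_⟩
      have h1 := hBball l (q i) i hl
      rw [Metric.mem_ball] at h1 hz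
      rw [← Real.dist_eq]
      linarith [dist_triangle_right (lam n i) z (c l)]
  · set Q := Finset.univ.filter (fun i => q i = j) with hQ
    have hQcard : (Q.card : ℝ) = ((Finset.univ.filter (fun i => p n i = j)).card : ℝ) := by
      rw [hQ, hq3 j]
    have hQlow : (1 - η) * X ≤ Q.card := hQcard ▸ hlow j
    have hXQ : X ≤ 2 * Q.card := by nlinarith
    have hQpos : (0 : ℝ) < Q.card := by linarith
    have hM0 : 0 ≤ M := (norm_nonneg _).trans (hM 0)
    have herr := norm_sum_sub_integral_le (μ j) s (fun l => Metric.ball (c l) ρ)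
      (fun l => measurableSet_ball) hdisj c (lam n) (fun l => B l j) (fun l => hBball l j) Q
      (fun l => (hBle l j).trans (mul_le_mul_of_nonneg_right hQlow measureReal_nonneg))
      F hF M ω hM (fun l y hy => hω y (c l) (by
        rw [Metric.mem_ball, Real.dist_eq] at hy
        linarith)) hω0
    change _ ≤ 2 * ω * (Q.card : ℝ) + M * (((Q.card : ℝ) - (A j).card)
      + Q.card * (1 - ∑ l ∈ s, (μ j).real (Metric.ball (c l) ρ)) + (A j \ Q).card
      + (Q \ A j).card) at herr
    have hsd : ((Q \ A j).card : ℝ) = Q.card - (A j).card + (A j \ Q).card := by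
      have h1 := Finset.card_sdiff_add_card_inter Q (A j)
      have h2 := Finset.card_sdiff_add_card_inter (A j) Q
      rw [Finset.inter_comm] at h2
      have h1' : ((Q \ A j).card : ℝ) + (Q ∩ A j).card = Q.card := by exact_mod_cast h1
      have h2' : ((A j \ Q).card : ℝ) + (Q ∩ A j).card = (A j).card := by exact_mod_cast h2
      linarith
    have hηX : η * X ≤ 2 * (η * Q.card) := by nlinarith
    have e1 : (Q.card : ℝ) - (A j).card ≤ 8 * (η * Q.card) := by
      have := hdef j
      rw [← hQcard] at this
      linarith
    have e2 : (Q.card : ℝ) * (1 - ∑ l ∈ s, (μ j).real (Metric.ball (c l) ρ)) ≤ η * Q.card := by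
      rw [mul_comm η]
      exact mul_le_mul_of_nonneg_left (by linarith [hmass j]) hQpos.le
    have e3 : ((A j \ Q).card : ℝ) ≤ 8 * (k : ℝ) ^ 2 * (η * Q.card) := by
      refine (hT j).trans ?_
      have := mul_le_mul_of_nonneg_left hηX (sq_nonneg (k : ℝ))
      linarith
    have htot : ‖∑ i ∈ Q, F (lam n i) - Q.card * ∫ y, F y ∂(μ j)‖
        ≤ (2 * ω + M * ((17 + 16 * (k : ℝ) ^ 2) * η)) * Q.card := by
      refine herr.trans ?_
      have : ((Q.card : ℝ) - (A j).card)
          + Q.card * (1 - ∑ l ∈ s, (μ j).real (Metric.ball (c l) ρ)) + (A j \ Q).card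
          + (Q \ A j).card ≤ (17 + 16 * (k : ℝ) ^ 2) * (η * Q.card) := by
        rw [hsd]
        linarith
      linarith [mul_le_mul_of_nonneg_left this hM0]
    have hQne : (Q.card : ℂ) ≠ 0 := by
      exact_mod_cast hQpos.ne'
    have heq : (Q.card : ℂ)⁻¹ * ∑ i ∈ Q, F (lam n i) - ∫ y, F y ∂(μ j)
        = (Q.card : ℂ)⁻¹ * (∑ i ∈ Q, F (lam n i) - Q.card * ∫ y, F y ∂(μ j)) := by
      rw [mul_sub, inv_mul_cancel_left₀ hQne]
    rw [heq, norm_mul, norm_inv, Complex.norm_natCast, inv_mul_eq_div, div_le_iff₀ hQpos]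
    exact htot

/-- The law of `g` under the uniform distribution on `[a,b]`. -/
noncomputable def uniformLaw (a b : ℝ) (g : ℝ → ℝ) : Measure ℝ :=
  (ProbabilityTheory.cond volume (Set.Icc a b)).map g

theorem isProbabilityMeasure_uniformLaw {a b : ℝ} (hab : a < b) {g : ℝ → ℝ} (hg : Measurable g) :
    IsProbabilityMeasure (uniformLaw a b g) := by
  have : IsProbabilityMeasure (ProbabilityTheory.cond volume (Set.Icc a b)) :=
    ProbabilityTheory.cond_isProbabilityMeasure_of_finite (by simpa using hab) (by simp)
  exact Measure.isProbabilityMeasure_map hg.aemeasurable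

theorem integral_uniformLaw {a b : ℝ} (hab : a < b) {g : ℝ → ℝ} (hg : Measurable g)
    {E : Type*} [NormedAddCommGroup E] [NormedSpace ℝ E] {F : ℝ → E} (hF : Continuous F)
    [SecondCountableTopology E] :
    ∫ y, F y ∂(uniformLaw a b g) = (b - a)⁻¹ • ∫ y in Set.Icc a b, F (g y) := by
  rw [uniformLaw, integral_map hg.aemeasurable hF.aestronglyMeasurable, ProbabilityTheory.cond,
    integral_smul_measure, Real.volume_Icc, ENNReal.toReal_inv,
    ENNReal.toReal_ofReal (sub_nonneg.2 hab.le)]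

/-- Every set charged by the law of `g` meets the essential range of `g`. -/
theorem exists_mem_essentialRangeOn {a b : ℝ} {g : ℝ → ℝ} (hg : Measurable g) {C : Set ℝ}
    (hC : uniformLaw a b g C ≠ 0) : ∃ z ∈ C, z ∈ essentialRangeOn a b g := by
  obtain ⟨z, hzC, hz⟩ := exists_mem_forall_mem_nhdsWithin_pos_measure hC
  refine ⟨z, hzC, fun ε hε => ?_⟩
  have h := hz _ (mem_nhdsWithin_of_mem_nhds (Metric.ball_mem_nhds z hε))
  rw [uniformLaw, Measure.map_apply hg measurableSet_ball,
    ProbabilityTheory.cond_apply measurableSet_Icc] at h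
  exact pos_iff_ne_zero.2 (right_ne_zero_of_mul h.ne')

/-- If `E n η` is eventually inhabited for all small `η > 0`, then witnesses can be chosen along a
sequence of accuracies tending to zero. -/
theorem exists_seq_tendsto_zero_of_eventually {α : ℕ → Type*} (E : ∀ n, ℝ → α n → Prop) {c : ℝ}
    (hc : 0 < c) (hE : ∀ η, 0 < η → η ≤ c → ∀ᶠ n in atTop, ∃ q, E n η q)
    (q₀ : ∀ n, α n) (δ₀ : ℕ → ℝ) :
    ∃ (q : ∀ n, α n) (δ : ℕ → ℝ), Tendsto δ atTop (nhds 0) ∧ (∀ᶠ n in atTop, E n (δ n) (q n)) ∧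
      ∀ n, E n (δ n) (q n) ∨ (q n = q₀ n ∧ δ n = δ₀ n) := by
  let A : ℕ → Set ℝ := fun n => {η | 0 < η ∧ ∃ q, E n η q}
  have hbdd : ∀ n, BddBelow (A n) := fun n => ⟨0, fun η hη => hη.1.le⟩
  have hex : ∀ n, ∃ (q : α n) (δ : ℝ),
      ((A n).Nonempty → 0 < δ ∧ E n δ q ∧ δ < sInf (A n) + 1 / ((n : ℝ) + 1)) ∧
      (E n δ q ∨ (q = q₀ n ∧ δ = δ₀ n)) := by
    intro n
    by_cases hne : (A n).Nonempty
    · obtain ⟨δ, ⟨hδ, q, hq⟩, hlt⟩ := exists_lt_of_csInf_lt hne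
        (lt_add_of_pos_right (sInf (A n)) (Nat.one_div_pos_of_nat (α := ℝ) (n := n)))
      exact ⟨q, δ, fun _ => ⟨hδ, hq, hlt⟩, Or.inl hq⟩
    · exact ⟨q₀ n, δ₀ n, fun h => absurd h hne, Or.inr ⟨rfl, rfl⟩⟩
  choose q δ h1 h2 using hex
  have hne : ∀ᶠ n in atTop, (A n).Nonempty :=
    (hE c hc le_rfl).mono fun n hn => ⟨c, hc, hn⟩
  refine ⟨q, δ, ?_, hne.mono fun n hn => (h1 n hn).2.1, h2⟩
  refine tendsto_order.2 ⟨fun x hx => hne.mono fun n hn => hx.trans (h1 n hn).1, fun x hx => ?_⟩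
  have hη : 0 < min c (x / 2) := lt_min hc (by linarith)
  filter_upwards [hE _ hη (min_le_left _ _), tendsto_one_div_add_atTop_nhds_zero_nat.eventually
    (gt_mem_nhds (half_pos hx))] with n hn hn'
  have hmem : min c (x / 2) ∈ A n := ⟨hη, hn⟩
  have := csInf_le (hbdd n) hmem
  have := (h1 n ⟨_, hmem⟩).2.2
  have := min_le_right c (x / 2)
  linarith

/-- (Lemma `ss2.g`.) Let `f_1,…,f_k : [a,b] → ℝ` be measurable and let
`{Λ_n}_n ∼ diag(f_1,…,f_k)`. If for every `n` there is a partition `{Λ̃_{n,1},…,Λ̃_{n,k}}` of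
`Λ_n` (encoded by `p n : Fin (d_n) → Fin k`) with `|Λ̃_{n,j}|/d_n → 1/k` and
`Λ̃_{n,j} ⊆ (ER(f_j))_{ε_n}` for some `ε_n → 0`, then for every `n` there is a partition
`{Λ_{n,1},…,Λ_{n,k}}` of `Λ_n` (encoded by `q n`) with `|Λ_{n,j}| = |Λ̃_{n,j}|`,
`{Λ_{n,j}}_n ∼ f_j`, and `Λ_{n,j} ⊆ (ER(f_j))_{δ_n}` for some `δ_n → 0`. -/
theorem stmt_5
    (a b : ℝ) (hab : a < b) (k : ℕ) (hk : 0 < k)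
    (f : Fin k → ℝ → ℝ) (hf : ∀ j, Measurable (f j))
    (dn : ℕ → ℕ) (hd : Tendsto dn atTop atTop)
    (lam : ∀ n, Fin (dn n) → ℝ)
    (hdistr : ∀ F : ℝ → ℂ, Continuous F → HasCompactSupport F →
      Tendsto (fun n => (dn n : ℂ)⁻¹ * ∑ i : Fin (dn n), F (lam n i)) atTop
        (nhds (((b - a)⁻¹ : ℝ) • ∫ y in Set.Icc a b, (∑ j : Fin k, F (f j y)) / (k : ℂ))))
    (p : ∀ n, Fin (dn n) → Fin k)
    (ε : ℕ → ℝ) (hε : Tendsto ε atTop (nhds 0))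
    (hpcard : ∀ j : Fin k, Tendsto (fun n =>
        ((Finset.univ.filter (fun i => p n i = j)).card : ℝ) / (dn n : ℝ)) atTop
        (nhds (1 / (k : ℝ))))
    (hpmem : ∀ n i, lam n i ∈ expansion (essentialRangeOn a b (f (p n i))) (ε n)) :
    ∃ q : ∀ n, Fin (dn n) → Fin k, ∃ δ : ℕ → ℝ, Tendsto δ atTop (nhds 0) ∧
      ∀ j : Fin k,
        (∀ n, (Finset.univ.filter (fun i => q n i = j)).card
            = (Finset.univ.filter (fun i => p n i = j)).card) ∧
        (∀ F : ℝ → ℂ, Continuous F → HasCompactSupport F →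
          Tendsto (fun n => (((Finset.univ.filter (fun i => q n i = j)).card : ℂ))⁻¹ *
              ∑ i ∈ Finset.univ.filter (fun i => q n i = j), F (lam n i)) atTop
            (nhds (((b - a)⁻¹ : ℝ) • ∫ y in Set.Icc a b, F (f j y)))) ∧
        (∀ n i, q n i = j → lam n i ∈ expansion (essentialRangeOn a b (f j)) (δ n)) := by
  have hprob : ∀ j, IsProbabilityMeasure (uniformLaw a b (f j)) := fun j =>
    isProbabilityMeasure_uniformLaw hab (hf j)
  have hreal : ∀ F : ℝ → ℝ, Continuous F → HasCompactSupport F →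
      Tendsto (fun n => (dn n : ℝ)⁻¹ * ∑ i, F (lam n i)) atTop
        (nhds ((∑ j, ∫ x, F x ∂(uniformLaw a b (f j))) / k)) := by
    intro F hF hFc
    have hFC : Continuous fun x => (F x : ℂ) := Complex.continuous_ofReal.comp hF
    have h := hdistr (fun x => (F x : ℂ)) hFC
      (hFc.comp_left (g := ((↑) : ℝ → ℂ)) Complex.ofReal_zero)
    obtain ⟨M, hM⟩ := hF.bounded_above_of_compact_support hFc
    have hint : ∀ j, Integrable (fun y => (F (f j y) : ℂ)) (volume.restrict (Set.Icc a b)) :=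
      fun j => Integrable.of_bound
        (hFC.measurable.comp (hf j)).aestronglyMeasurable M
        (Eventually.of_forall fun y => by simpa using hM (f j y))
    have hlim : ((b - a)⁻¹ : ℝ) • ∫ y in Set.Icc a b, (∑ j : Fin k, (F (f j y) : ℂ)) / (k : ℂ)
        = (((∑ j, ∫ x, F x ∂(uniformLaw a b (f j))) / k : ℝ) : ℂ) := by
      rw [integral_div, integral_finsetSum _ fun j _ => hint j]
      have hj : ∀ j, ((∫ x, F x ∂(uniformLaw a b (f j)) : ℝ) : ℂ)
          = ((b - a)⁻¹ : ℝ) * ∫ y in Set.Icc a b, (F (f j y) : ℂ) := fun j => by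
        rw [integral_uniformLaw hab (hf j) hF, smul_eq_mul, Complex.ofReal_mul,
          integral_complex_ofReal]
      rw [Complex.ofReal_div, Complex.ofReal_sum, Finset.sum_congr rfl fun j _ => hj j,
        ← Finset.mul_sum, Complex.real_smul, mul_div_assoc, Complex.ofReal_natCast]
    rw [hlim] at h
    have hre := (Complex.continuous_re.tendsto _).comp h
    rw [Complex.ofReal_re] at hre
    refine hre.congr fun n => ?_
    have : (dn n : ℂ)⁻¹ * ∑ i, (F (lam n i) : ℂ)
        = (((dn n : ℝ)⁻¹ * ∑ i, F (lam n i) : ℝ) : ℂ) := by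
      push_cast
      rfl
    simp only [Function.comp_apply, this, Complex.ofReal_re]
  obtain ⟨q, δ, hδ, hev, hall⟩ := exists_seq_tendsto_zero_of_eventually
    (fun n η (q : Fin (dn n) → Fin k) =>
      (∀ j, (Finset.univ.filter (fun i => q i = j)).card
        = (Finset.univ.filter (fun i => p n i = j)).card) ∧
      (∀ i, lam n i ∈ expansion (essentialRangeOn a b (f (q i))) η) ∧
      ∀ (j : Fin k) (F : ℝ → ℂ) (M ω : ℝ), Continuous F → (∀ y, ‖F y‖ ≤ M) → 0 ≤ ω →
        (∀ y z, |y - z| < η → ‖F y - F z‖ ≤ ω) →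
        ‖((Finset.univ.filter (fun i => q i = j)).card : ℂ)⁻¹ *
            ∑ i ∈ Finset.univ.filter (fun i => q i = j), F (lam n i)
              - ∫ y, F y ∂(uniformLaw a b (f j))‖
          ≤ 2 * ω + M * ((17 + 16 * (k : ℝ) ^ 2) * η))
    one_half_pos
    (fun η hη hη1 => eventually_exists_good_partition hk (fun j => uniformLaw a b (f j))
      (fun j => essentialRangeOn a b (f j)) (fun j _ hC => exists_mem_essentialRangeOn (hf j) hC)
      dn hd lam hreal p ε hε hpcard hpmem hη hη1) p ε
  refine ⟨q, δ, hδ, fun j => ⟨fun n => ?_, fun F hF hFc => ?_, fun n i hi => ?_⟩⟩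
  · rcases hall n with h | h
    · exact h.1 j
    · rw [h.1]
  · rw [← integral_uniformLaw hab (hf j) hF]
    obtain ⟨M, hM⟩ := hF.bounded_above_of_compact_support hFc
    refine Metric.tendsto_nhds.2 fun e he => ?_
    obtain ⟨η, hη, hunif⟩ := Metric.uniformContinuous_iff.1
      (hFc.uniformContinuous_of_continuous hF) (e / 4) (by positivity)
    have hlim : Tendsto (fun n => M * ((17 + 16 * (k : ℝ) ^ 2) * δ n)) atTop (nhds 0) := by
      simpa using (hδ.const_mul (17 + 16 * (k : ℝ) ^ 2)).const_mul M
    filter_upwards [hev, hδ.eventually (gt_mem_nhds hη),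
      hlim.eventually (gt_mem_nhds (half_pos he))] with n hn hδn hsmall
    have h := hn.2.2 j F M (e / 4) hF hM (by positivity) fun y z hyz => by
      rw [← dist_eq_norm]
      exact (hunif (by rw [Real.dist_eq]; exact hyz.trans hδn)).le
    rw [dist_eq_norm]
    linarith
  · subst hi
    rcases hall n with h | h
    · exact h.2.1 i
    · rw [h.1, h.2]
      exact hpmem n i
end

section
/- Let f : Ω ⊂ ℝ^d → ℝ be measurable on a set Ω with 0 < μ_d(Ω) < ∞, and let f† : (0,1) → ℝ be its monotone rearrangement. Then the essential range of f† (as a measurable function on (0,1) with the Lebesgue measure) equals the essential range of f: ER(f†) = ER(f). -/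
open MeasureTheory Filter

/-- The monotone rearrangement (quantile function) of `f : Ω ⊆ ℝ^d → ℝ`:
`f†(y) = inf {u : μ_d{x ∈ Ω : f x ≤ u} / μ_d(Ω) ≥ y}`. -/
noncomputable def monotoneRearrangement (d : ℕ) (Ω : Set (Fin d → ℝ))
    (f : (Fin d → ℝ) → ℝ) (y : ℝ) : ℝ :=
  sInf {u : ℝ | ENNReal.ofReal y ≤ volume {x ∈ Ω | f x ≤ u} / volume Ω}

/-- The essential range of `f : Ω ⊆ ℝ^d → ℝ`. -/
def essentialRange (d : ℕ) (Ω : Set (Fin d → ℝ)) (f : (Fin d → ℝ) → ℝ) : Set ℝ :=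
  {z : ℝ | ∀ ε : ℝ, 0 < ε → 0 < volume {x ∈ Ω | |f x - z| < ε}}

open ProbabilityTheory Set in
/-- The Galois connection between the quantile function and the cumulative distribution function. -/
theorem sInf_le_cdf_le_iff (P : Measure ℝ) [IsProbabilityMeasure P] {y : ℝ}
    (hy : y ∈ Ioo (0 : ℝ) 1) (u : ℝ) : sInf {v : ℝ | y ≤ cdf P v} ≤ u ↔ y ≤ cdf P u := by
  have hne : {v : ℝ | y ≤ cdf P v}.Nonempty :=
    ((tendsto_cdf_atTop P).eventually (eventually_ge_nhds hy.2)).exists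
  have hbdd : BddBelow {v : ℝ | y ≤ cdf P v} := by
    obtain ⟨b, hb⟩ := ((tendsto_cdf_atBot P).eventually (eventually_lt_nhds hy.1)).exists
    refine ⟨b, fun v hv => ?_⟩
    by_contra! h
    exact absurd (hv.trans (monotone_cdf P h.le)) (not_le.2 hb)
  refine ⟨fun h => ?_, fun h => csInf_le hbdd h⟩
  have hright : Tendsto (cdf P) (nhdsWithin u (Ioi u)) (nhds (cdf P u)) :=
    ((cdf P).right_continuous u).tendsto.mono_left (nhdsWithin_mono u Ioi_subset_Ici_self)
  refine ge_of_tendsto hright ?_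
  filter_upwards [self_mem_nhdsWithin] with v hv
  obtain ⟨w, hw, hwv⟩ := exists_lt_of_csInf_lt hne (h.trans_lt hv)
  exact le_trans hw (monotone_cdf P hwv.le)

open ProbabilityTheory Set in
theorem aemeasurable_sInf_le_cdf (P : Measure ℝ) [IsProbabilityMeasure P] :
    AEMeasurable (fun y => sInf {v : ℝ | y ≤ cdf P v}) (volume.restrict (Ioo (0 : ℝ) 1)) := by
  refine aemeasurable_restrict_of_monotoneOn measurableSet_Ioo fun a ha b hb hab => ?_
  rw [sInf_le_cdf_le_iff P ha]
  exact hab.trans ((sInf_le_cdf_le_iff P hb _).1 le_rfl)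

open ProbabilityTheory Set in
/-- The quantile function of `P` pushes the uniform distribution on `(0,1)` forward to `P`. -/
theorem map_sInf_le_cdf (P : Measure ℝ) [IsProbabilityMeasure P] :
    (volume.restrict (Ioo (0 : ℝ) 1)).map (fun y => sInf {v : ℝ | y ≤ cdf P v}) = P := by
  refine Measure.ext_of_Iic _ _ fun u => ?_
  rw [Measure.map_apply_of_aemeasurable (aemeasurable_sInf_le_cdf P) measurableSet_Iic,
    Measure.restrict_apply' measurableSet_Ioo]
  have hset : (fun y => sInf {v : ℝ | y ≤ cdf P v}) ⁻¹' Iic u ∩ Ioo 0 1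
      = Iic (cdf P u) ∩ Ioo 0 1 := by
    ext y
    exact and_congr_left fun hy => sInf_le_cdf_le_iff P hy u
  rw [hset, measure_congr ((ae_eq_refl _).inter Ioo_ae_eq_Ioc), inter_comm, Ioc_inter_Iic,
    Real.volume_Ioc, min_eq_right (cdf_le_one P u), sub_zero, ofReal_cdf]

open ProbabilityTheory Set in
theorem monotoneRearrangement_eq_sInf_le_cdf {d : ℕ} {Ω : Set (Fin d → ℝ)}
    {f : (Fin d → ℝ) → ℝ} (hf : Measurable f) [IsProbabilityMeasure (volume[|Ω].map f)]
    (hΩ : MeasurableSet Ω) (y : ℝ) :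
    monotoneRearrangement d Ω f y = sInf {v : ℝ | y ≤ cdf (volume[|Ω].map f) v} := by
  unfold monotoneRearrangement
  congr 1
  ext u
  have h : volume {x ∈ Ω | f x ≤ u} / volume Ω
      = ENNReal.ofReal (cdf (volume[|Ω].map f) u) := by
    rw [ofReal_cdf, Measure.map_apply hf measurableSet_Iic, cond_apply hΩ,
      ENNReal.div_eq_inv_mul]
    rfl
  rw [mem_ofPred_eq, h, ENNReal.ofReal_le_ofReal_iff (cdf_nonneg _ u), mem_ofPred_eq]

open ProbabilityTheory in
/-- The essential range of `f†` (as a function on `(0,1)` with the Lebesgue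
measure) equals the essential range of `f`. -/
theorem stmt_9 (d : ℕ) (Ω : Set (Fin d → ℝ)) (hΩ : MeasurableSet Ω)
    (f : (Fin d → ℝ) → ℝ) (hf : Measurable f)
    (hΩpos : 0 < volume Ω) (hΩfin : volume Ω < ⊤) :
    {z : ℝ | ∀ ε : ℝ, 0 < ε →
        0 < volume {y ∈ Set.Ioo (0 : ℝ) 1 | |monotoneRearrangement d Ω f y - z| < ε}}
      = essentialRange d Ω f := by
  have : IsProbabilityMeasure (volume[|Ω]) :=
    cond_isProbabilityMeasure_of_finite hΩpos.ne' hΩfin.ne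
  have : IsProbabilityMeasure (volume[|Ω].map f) :=
    Measure.isProbabilityMeasure_map hf.aemeasurable
  have key (z ε : ℝ) :
      volume {y ∈ Set.Ioo (0 : ℝ) 1 | |monotoneRearrangement d Ω f y - z| < ε}
        = (volume Ω)⁻¹ * volume {x ∈ Ω | |f x - z| < ε} := by
    have hball : MeasurableSet {t : ℝ | |t - z| < ε} := by measurability
    have h := congrArg (· {t : ℝ | |t - z| < ε}) (map_sInf_le_cdf (volume[|Ω].map f))
    simp only [← monotoneRearrangement_eq_sInf_le_cdf hf hΩ] at h
    rw [Measure.map_apply hf hball, cond_apply hΩ, Measure.map_apply_of_aemeasurable _ hball,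
      Measure.restrict_apply' measurableSet_Ioo, Set.inter_comm] at h
    · exact h
    · simpa only [← monotoneRearrangement_eq_sInf_le_cdf hf hΩ]
        using aemeasurable_sInf_le_cdf (volume[|Ω].map f)
  ext z
  simp only [essentialRange, Set.mem_ofPred_eq, key, CanonicallyOrderedAdd.mul_pos,
    ENNReal.inv_pos, ne_eq, hΩfin.ne, not_false_eq_true, true_and]
end

section
/- Let f : Ω ⊂ ℝ^d → ℝ be measurable on a set Ω with 0 < μ_d(Ω) < ∞, and let f† : (0,1) → ℝ be its monotone rearrangement. Then f† is continuous on (0,1) if and only if the essential range ER(f) is a connected subset of ℝ. -/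
open MeasureTheory Filter

open Set ProbabilityTheory Topology

/-- The quantile function of a measure on `ℝ`. -/
noncomputable def quantile (ν : Measure ℝ) (y : ℝ) : ℝ :=
  sInf {u : ℝ | y ≤ cdf ν u}

theorem quantile_le_iff (ν : Measure ℝ) {y u : ℝ} (hy : y ∈ Ioo (0 : ℝ) 1) :
    quantile ν y ≤ u ↔ y ≤ cdf ν u := by
  have hbdd : BddBelow {u : ℝ | y ≤ cdf ν u} := by
    obtain ⟨a, ha⟩ := ((tendsto_cdf_atBot ν).eventually_lt_const hy.1).exists
    exact ⟨a, fun v hv ↦ le_of_not_gt fun h ↦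
      absurd (hv.trans (monotone_cdf ν h.le)) (not_le.2 ha)⟩
  have hne : {u : ℝ | y ≤ cdf ν u}.Nonempty := by
    obtain ⟨b, hb⟩ := ((tendsto_cdf_atTop ν).eventually_const_lt hy.2).exists
    exact ⟨b, hb.le⟩
  refine ⟨fun h ↦ ?_, fun h ↦ csInf_le hbdd h⟩
  have hcont : Tendsto (cdf ν) (𝓝[>] u) (𝓝 (cdf ν u)) :=
    ((cdf ν).right_continuous u).mono_left (nhdsWithin_mono _ Ioi_subset_Ici_self)
  refine ge_of_tendsto hcont (eventually_mem_nhdsWithin.mono fun v hv ↦ ?_)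
  obtain ⟨w, hw, hwv⟩ := exists_lt_of_csInf_lt hne (h.trans_lt hv)
  exact le_trans hw (monotone_cdf ν hwv.le)

theorem lt_quantile_iff (ν : Measure ℝ) {y u : ℝ} (hy : y ∈ Ioo (0 : ℝ) 1) :
    u < quantile ν y ↔ cdf ν u < y := by
  rw [← not_le, quantile_le_iff ν hy, not_le]

theorem exists_mem_support_of_measure_pos {ν : Measure ℝ} {s : Set ℝ} (hs : 0 < ν s) :
    ∃ x ∈ s, x ∈ ν.support := by
  by_contra! h
  exact hs.ne' (measure_mono_null (fun x hx ↦ h x hx) Measure.measure_compl_support)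

theorem measure_Ioc_eq_ofReal_cdf_sub (ν : Measure ℝ) [IsProbabilityMeasure ν] (a b : ℝ) :
    ν (Ioc a b) = ENNReal.ofReal (cdf ν b - cdf ν a) := by
  conv_lhs => rw [← measure_cdf ν]
  exact (cdf ν).measure_Ioc a b

theorem measure_Ioi_eq_ofReal_one_sub_cdf (ν : Measure ℝ) [IsProbabilityMeasure ν] (a : ℝ) :
    ν (Ioi a) = ENNReal.ofReal (1 - cdf ν a) := by
  conv_lhs => rw [← measure_cdf ν]
  exact (cdf ν).measure_Ioi (tendsto_cdf_atTop ν) a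

theorem measure_pos_of_mem_support {ν : Measure ℝ} {x : ℝ} {s : Set ℝ}
    (hx : x ∈ ν.support) (hs : s ∈ 𝓝 x) : 0 < ν s :=
  (Measure.mem_support_iff_forall x).1 hx s hs

theorem continuousOn_quantile_of_isPreconnected_support (ν : Measure ℝ)
    [IsProbabilityMeasure ν] (h : IsPreconnected ν.support) :
    ContinuousOn (quantile ν) (Ioo 0 1) := by
  intro y hy
  have hord := h.ordConnected
  refine tendsto_order.2 ⟨fun b hb ↦ ?_, fun b hb ↦ ?_⟩
  · have hb := (lt_quantile_iff ν hy).1 hb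
    filter_upwards [self_mem_nhdsWithin, nhdsWithin_le_nhds (lt_mem_nhds hb)] with z hz hbz
    exact (lt_quantile_iff ν hz).2 hbz
  · obtain ⟨cut, hcut, hlt⟩ : ∃ cut < b, y < cdf ν cut := by
      by_contra! hle
      have hq : y ≤ cdf ν (quantile ν y) := (quantile_le_iff ν hy).1 le_rfl
      obtain ⟨m, hqm, hmb⟩ := exists_between hb
      obtain ⟨c, hmc, hcb⟩ := exists_between hmb
      obtain ⟨s, hs, hsS⟩ := exists_mem_support_of_measure_pos (ν := ν) (s := Iic (quantile ν y))
        (by rw [← ofReal_cdf]; exact ENNReal.ofReal_pos.2 (hy.1.trans_le hq))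
      obtain ⟨t, ht, htS⟩ := exists_mem_support_of_measure_pos (ν := ν) (s := Ioi c)
        (by
          rw [measure_Ioi_eq_ofReal_one_sub_cdf]
          exact ENNReal.ofReal_pos.2 (by linarith [hle c hcb, hy.2]))
      have hpos := measure_pos_of_mem_support
        (hord.out hsS htS ⟨le_trans hs hqm.le, hmc.le.trans (le_of_lt ht)⟩) (Ioc_mem_nhds hqm hmc)
      rw [measure_Ioc_eq_ofReal_cdf_sub, ENNReal.ofReal_pos] at hpos
      linarith [hle c hcb]
    filter_upwards [self_mem_nhdsWithin, nhdsWithin_le_nhds (gt_mem_nhds hlt)] with z hz hzb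
    exact ((quantile_le_iff ν hz).2 hzb.le).trans_lt hcut

theorem isPreconnected_support_of_continuousOn_quantile (ν : Measure ℝ)
    [IsProbabilityMeasure ν] (h : ContinuousOn (quantile ν) (Ioo 0 1)) :
    IsPreconnected ν.support := by
  have himage : OrdConnected (quantile ν '' Ioo 0 1) :=
    (isPreconnected_Ioo.image _ h).ordConnected
  refine OrdConnected.isPreconnected ⟨fun a ha b hb c hc ↦ ?_⟩
  by_contra hcS
  have hac : a < c := lt_of_le_of_ne hc.1 fun hac ↦ hcS (hac ▸ ha)
  have hcb : c < b := lt_of_le_of_ne hc.2 fun hcb ↦ hcS (hcb ▸ hb)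
  obtain ⟨s, hs, hνs⟩ := Measure.notMem_support_iff_exists.1 hcS
  obtain ⟨l, u, hlu, hsub⟩ := mem_nhds_iff_exists_Ioo_subset.1 hs
  obtain ⟨m, hlm, hmc⟩ := exists_between hlu.1
  have hm : cdf ν c ≤ cdf ν m := by
    have hzero : ν (Ioc m c) = 0 :=
      measure_mono_null (fun x hx ↦ hsub ⟨hlm.trans hx.1, hx.2.trans_lt hlu.2⟩) hνs
    rw [measure_Ioc_eq_ofReal_cdf_sub, ENNReal.ofReal_eq_zero] at hzero
    linarith
  have hpos : 0 < cdf ν c := by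
    have := measure_pos_of_mem_support ha (Iic_mem_nhds hac)
    rwa [← ofReal_cdf, ENNReal.ofReal_pos] at this
  have hlt : cdf ν c < 1 := by
    have := measure_pos_of_mem_support hb (Ioi_mem_nhds hcb)
    rw [measure_Ioi_eq_ofReal_one_sub_cdf, ENNReal.ofReal_pos] at this
    linarith
  obtain ⟨y, hcy, hy⟩ := exists_between hlt
  have hyI : y ∈ Ioo (0 : ℝ) 1 := ⟨hpos.trans hcy, hy⟩
  obtain ⟨z, hz, hzc⟩ := himage.out (mem_image_of_mem _ ⟨hpos, hlt⟩) (mem_image_of_mem _ hyI)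
    ⟨(quantile_le_iff ν ⟨hpos, hlt⟩).2 le_rfl, ((lt_quantile_iff ν hyI).2 hcy).le⟩
  have hzm := (quantile_le_iff ν hz).2 (((quantile_le_iff ν hz).1 hzc.le).trans hm)
  linarith

theorem continuousOn_quantile_iff_isPreconnected_support (ν : Measure ℝ)
    [IsProbabilityMeasure ν] :
    ContinuousOn (quantile ν) (Ioo 0 1) ↔ IsPreconnected ν.support :=
  ⟨isPreconnected_support_of_continuousOn_quantile ν,
    continuousOn_quantile_of_isPreconnected_support ν⟩

theorem map_cond_apply {α : Type*} [MeasurableSpace α] {μ : Measure α} {Ω : Set α}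
    (hΩ : MeasurableSet Ω) {f : α → ℝ} (hf : Measurable f) {s : Set ℝ} (hs : MeasurableSet s) :
    (μ[|Ω]).map f s = μ {x ∈ Ω | f x ∈ s} / μ Ω := by
  rw [Measure.map_apply hf hs, cond_apply hΩ, ENNReal.div_eq_inv_mul]
  rfl

/-- `f†` is continuous on `(0,1)` if and only if the essential range of `f`
is a connected subset of `ℝ`. -/
theorem stmt_10 (d : ℕ) (Ω : Set (Fin d → ℝ)) (hΩ : MeasurableSet Ω)
    (f : (Fin d → ℝ) → ℝ) (hf : Measurable f)
    (hΩpos : 0 < volume Ω) (hΩfin : volume Ω < ⊤) :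
    ContinuousOn (monotoneRearrangement d Ω f) (Set.Ioo 0 1)
      ↔ IsPreconnected (essentialRange d Ω f) := by
  have := cond_isProbabilityMeasure_of_finite hΩpos.ne' hΩfin.ne
  have := Measure.isProbabilityMeasure_map (μ := volume[|Ω]) hf.aemeasurable
  have hquantile : monotoneRearrangement d Ω f = quantile ((volume[|Ω]).map f) := by
    funext y
    refine congrArg sInf (Set.ext fun u ↦ ?_)
    have hcdf := map_cond_apply (μ := volume) hΩ hf (measurableSet_Iic (a := u))
    rw [← ofReal_cdf] at hcdf
    change ENNReal.ofReal y ≤ volume {x ∈ Ω | f x ∈ Iic u} / volume Ω ↔ _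
    rw [← hcdf, ENNReal.ofReal_le_ofReal_iff (cdf_nonneg _ _)]
    rfl
  have hsupport : essentialRange d Ω f = ((volume[|Ω]).map f).support := by
    ext z
    rw [Metric.nhds_basis_ball.mem_measureSupport]
    refine forall₂_congr fun ε _ ↦ ?_
    rw [map_cond_apply hΩ hf measurableSet_ball, ENNReal.div_pos_iff]
    simp [pos_iff_ne_zero, hΩfin.ne, Real.dist_eq]
  rw [hquantile, hsupport]
  exact continuousOn_quantile_iff_isPreconnected_support _
end

section
/- Let f : Ω ⊂ ℝ^d → ℝ be bounded and continuous almost everywhere on a regular set Ω with μ_d(Ω) > 0, and assume ER(f) = [inf_Ω f, sup_Ω f]. Let [a,b] be a closed d-dimensional rectangle containing Ω, let n ↦ 𝐧(n) ∈ ℕ^d with min(𝐧(n)) → ∞, and for every n let {x_{𝐢,𝐧}^{(n)}}_{𝐢=𝟏,…,𝐧} be an asymptotically uniform grid in [a,b]. For every n, sort the samples f(x_{𝐢,𝐧}^{(n)}) over the indices 𝐢 with x_{𝐢,𝐧}^{(n)} ∈ Ω in increasing order into a vector [s_0,…,s_{ω(n)}], where ω(n)+1 is the number of such indices, and let f†_n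 : [0,1] → ℝ be the piecewise linear function with f†_n(ℓ/ω(n)) = s_ℓ for ℓ = 0,…,ω(n) and linear on each interval [ℓ/ω(n),(ℓ+1)/ω(n)]. Extend the monotone rearrangement f† to [0,1] by f†(0) = ess inf_Ω f and f†(1) = ess sup_Ω f. Then f†_n → f† uniformly on [0,1] as n → ∞. -/
open MeasureTheory Filter
open scoped Classical

/-- The monotone rearrangement extended to `[0,1]` by `f†(0) = ess inf_Ω f = inf ER(f)` and
`f†(1) = ess sup_Ω f = sup ER(f)`. -/
noncomputable def monotoneRearrangementExt (d : ℕ) (Ω : Set (Fin d → ℝ))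
    (f : (Fin d → ℝ) → ℝ) (y : ℝ) : ℝ :=
  if y ≤ 0 then sInf (essentialRange d Ω f)
  else if 1 ≤ y then sSup (essentialRange d Ω f)
  else monotoneRearrangement d Ω f y

/-- The linear spline interpolating the values `s 0, s 1, …, s ω` at the equally spaced
nodes `0, 1/ω, 2/ω, …, 1` of `[0,1]`. -/
noncomputable def linearSpline (ω : ℕ) (s : ℕ → ℝ) (y : ℝ) : ℝ :=
  s (min (⌊y * (ω : ℝ)⌋.toNat) (ω - 1)) +
    (y * (ω : ℝ) - (min (⌊y * (ω : ℝ)⌋.toNat) (ω - 1) : ℕ)) *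
      (s (min (⌊y * (ω : ℝ)⌋.toNat) (ω - 1) + 1) - s (min (⌊y * (ω : ℝ)⌋.toNat) (ω - 1)))

/-- The half-open cell with multi-index `i` of the partition of `[a, b)` into `N` boxes. -/
def gridCell {d : ℕ} (a b : Fin d → ℝ) (N : Fin d → ℕ) (i : ∀ j, Fin (N j)) :
    Set (Fin d → ℝ) :=
  Set.univ.pi fun j => Set.Ico (a j + ((i j : ℕ) : ℝ) * ((b j - a j) / N j))
    (a j + (((i j : ℕ) : ℝ) + 1) * ((b j - a j) / N j))

lemma gridCell_measurableSet {d : ℕ} (a b : Fin d → ℝ) (N : Fin d → ℕ)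
    (i : ∀ j, Fin (N j)) : MeasurableSet (gridCell a b N i) :=
  MeasurableSet.univ_pi fun _ => measurableSet_Ico

lemma volume_gridCell {d : ℕ} {a b : Fin d → ℝ} (hab : ∀ j, a j < b j) (N : Fin d → ℕ)
    (i : ∀ j, Fin (N j)) :
    volume (gridCell a b N i) = ENNReal.ofReal (∏ j, (b j - a j) / N j) := by
  rw [gridCell, Real.volume_pi_Ico, ENNReal.ofReal_prod_of_nonneg]
  · refine Finset.prod_congr rfl fun j _ => ?_
    congr 1; ring
  · intro j _
    have := hab j
    exact div_nonneg (by linarith) (Nat.cast_nonneg _)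

lemma gridCell_subset_Icc {d : ℕ} {a b : Fin d → ℝ} (hab : ∀ j, a j < b j) (N : Fin d → ℕ)
    (i : ∀ j, Fin (N j)) : gridCell a b N i ⊆ Set.Icc a b := by
  intro t ht
  have key : ∀ j, a j ≤ t j ∧ t j ≤ b j := by
    intro j
    have h1 := ht j (Set.mem_univ j)
    have hi : ((i j : ℕ) : ℝ) + 1 ≤ N j := by exact_mod_cast (i j).2
    have hN : (0 : ℝ) < N j := by have : (0 : ℝ) ≤ ((i j : ℕ) : ℝ) := Nat.cast_nonneg _; linarith
    have hh : 0 < (b j - a j) / N j := div_pos (sub_pos.2 (hab j)) hN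
    have hm : (N j : ℝ) * ((b j - a j) / N j) = b j - a j := by field_simp
    have h2 := mul_le_mul_of_nonneg_right hi hh.le
    have h3 : 0 ≤ ((i j : ℕ) : ℝ) * ((b j - a j) / N j) := by positivity
    constructor
    · linarith [h1.1]
    · linarith [h1.2]
  exact ⟨fun j => (key j).1, fun j => (key j).2⟩

lemma gridCell_pairwise_disjoint {d : ℕ} {a b : Fin d → ℝ} (hab : ∀ j, a j < b j)
    (N : Fin d → ℕ) : Pairwise (Function.onFun Disjoint (gridCell a b N)) := by
  intro i i' hne
  rw [Function.onFun, Set.disjoint_left]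
  intro t ht ht'
  refine hne (funext fun j => Fin.ext ?_)
  have h1 := ht j (Set.mem_univ j)
  have h2 := ht' j (Set.mem_univ j)
  have hN : (0 : ℝ) < N j := by exact_mod_cast (i j).pos
  have hh : 0 < (b j - a j) / N j := div_pos (sub_pos.2 (hab j)) hN
  have h3 : ((i j : ℕ) : ℝ) < ((i' j : ℕ) : ℝ) + 1 :=
    lt_of_mul_lt_mul_right (by linarith [h1.1, h2.2]) hh.le
  have h4 : ((i' j : ℕ) : ℝ) < ((i j : ℕ) : ℝ) + 1 :=
    lt_of_mul_lt_mul_right (by linarith [h2.1, h1.2]) hh.le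
  have h5 : (i j : ℕ) < (i' j : ℕ) + 1 := by exact_mod_cast h3
  have h6 : (i' j : ℕ) < (i j : ℕ) + 1 := by exact_mod_cast h4
  omega

lemma exists_mem_gridCell {d : ℕ} {a b : Fin d → ℝ} (hab : ∀ j, a j < b j) {N : Fin d → ℕ}
    (hN : ∀ j, 0 < N j) {t : Fin d → ℝ} (ht : t ∈ Set.univ.pi fun j => Set.Ico (a j) (b j)) :
    ∃ i, t ∈ gridCell a b N i := by
  have key : ∀ j, ∃ k : Fin (N j),
      t j ∈ Set.Ico (a j + ((k : ℕ) : ℝ) * ((b j - a j) / N j))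
        (a j + (((k : ℕ) : ℝ) + 1) * ((b j - a j) / N j)) := by
    intro j
    have h1 := ht j (Set.mem_univ j)
    have hN' : (0 : ℝ) < N j := by exact_mod_cast hN j
    have hh : 0 < (b j - a j) / N j := div_pos (sub_pos.2 (hab j)) hN'
    have h0 : 0 ≤ (t j - a j) / ((b j - a j) / N j) := div_nonneg (by linarith [h1.1]) hh.le
    have hlt : (t j - a j) / ((b j - a j) / N j) < N j := by
      rw [div_lt_iff₀ hh]
      have hm : (N j : ℝ) * ((b j - a j) / N j) = b j - a j := by field_simp
      rw [hm]; linarith [h1.2]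
    refine ⟨⟨⌊(t j - a j) / ((b j - a j) / N j)⌋₊, (Nat.floor_lt h0).2 hlt⟩, ?_, ?_⟩
    · have := (le_div_iff₀ hh).1 (Nat.floor_le h0)
      simp only; linarith
    · have := (div_lt_iff₀ hh).1 (Nat.lt_floor_add_one ((t j - a j) / ((b j - a j) / N j)))
      simp only; linarith
  choose i hi using key
  exact ⟨i, fun j _ => hi j⟩

/-- The points of an asymptotically uniform grid are uniformly close to all points of the
corresponding cells. -/
lemma eventually_dist_grid_lt {d : ℕ} {a b : Fin d → ℝ}
    {N : ℕ → Fin d → ℕ} (hN : ∀ j, Tendsto (fun n => N n j) atTop atTop)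
    {x : ∀ n, (∀ j, Fin (N n j)) → (Fin d → ℝ)}
    (hau : Tendsto (fun n => ⨆ i : ∀ j, Fin (N n j), ⨆ j : Fin d,
        |x n i j - (a j + (((i j : ℕ) : ℝ) + 1) * (b j - a j) / (N n j : ℝ))|)
      atTop (nhds 0)) {ε : ℝ} (hε : 0 < ε) :
    ∀ᶠ n in atTop, ∀ i, ∀ t ∈ gridCell a b (N n) i, dist (x n i) t < ε := by
  have h1 := hau.eventually_lt_const (half_pos hε)
  have h2 : ∀ᶠ n in atTop, ∀ j, (b j - a j) / N n j < ε / 2 := by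
    rw [eventually_all]
    intro j
    have : Tendsto (fun n => (b j - a j) / (N n j : ℝ)) atTop (nhds 0) :=
      (tendsto_natCast_atTop_atTop.comp (hN j)).const_div_atTop _
    exact this.eventually_lt_const (half_pos hε)
  filter_upwards [h1, h2] with n h1 h2 i t ht
  rw [dist_pi_lt_iff hε]
  intro j
  have h3 : |x n i j - (a j + (((i j : ℕ) : ℝ) + 1) * (b j - a j) / (N n j : ℝ))| < ε / 2 := by
    refine lt_of_le_of_lt ?_ h1
    refine le_trans ?_ (le_ciSup (Set.finite_range _).bddAbove i)
    exact le_ciSup (f := fun j : Fin d =>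
      |x n i j - (a j + (((i j : ℕ) : ℝ) + 1) * (b j - a j) / (N n j : ℝ))|)
      (Set.finite_range _).bddAbove j
  have h4 := ht j (Set.mem_univ j)
  have h5 := h2 j
  rw [mul_div_assoc] at h3
  rw [Real.dist_eq]
  rw [abs_lt] at h3 ⊢
  have h6 : (((i j : ℕ) : ℝ) + 1) * ((b j - a j) / N n j) =
      ((i j : ℕ) : ℝ) * ((b j - a j) / N n j) + (b j - a j) / N n j := by ring
  constructor <;> linarith [h3.1, h3.2, h4.1, h4.2]

/-- Asymptotically uniform grids are equidistributed: the normalized number of grid points in a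
set with null boundary converges to the measure of that set. -/
lemma tendsto_card_grid_mul_volume {d : ℕ} {a b : Fin d → ℝ} (hab : ∀ j, a j < b j)
    {N : ℕ → Fin d → ℕ} (hN : ∀ j, Tendsto (fun n => N n j) atTop atTop)
    {x : ∀ n, (∀ j, Fin (N n j)) → (Fin d → ℝ)}
    (hau : Tendsto (fun n => ⨆ i : ∀ j, Fin (N n j), ⨆ j : Fin d,
        |x n i j - (a j + (((i j : ℕ) : ℝ) + 1) * (b j - a j) / (N n j : ℝ))|)
      atTop (nhds 0))
    {E : Set (Fin d → ℝ)} (hE : E ⊆ Set.Icc a b) (hEf : volume (frontier E) = 0) :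
    Tendsto (fun n => ((Finset.univ.filter (fun i => x n i ∈ E)).card : ℝ) *
      ∏ j, (b j - a j) / N n j) atTop (nhds (volume E).toReal) := by
  set A : ℕ → Set (Fin d → ℝ) := fun n =>
    ⋃ i ∈ Finset.univ.filter (fun i => x n i ∈ E), gridCell a b (N n) i with hA
  have hAm : ∀ n, MeasurableSet (A n) := fun n =>
    Finset.measurableSet_biUnion _ fun i _ => gridCell_measurableSet a b (N n) i
  have hAIcc : ∀ n, A n ⊆ Set.Icc a b := fun n =>
    Set.iUnion₂_subset fun i _ => gridCell_subset_Icc hab (N n) i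
  have hIcc : volume (Set.Icc a b) ≠ ⊤ := isCompact_Icc.measure_lt_top.ne
  have hAv : ∀ n, (volume (A n)).toReal =
      ((Finset.univ.filter (fun i => x n i ∈ E)).card : ℝ) * ∏ j, (b j - a j) / N n j := by
    intro n
    rw [hA, measure_biUnion_finset (fun i _ i' _ h => gridCell_pairwise_disjoint hab (N n) h)
      (fun i _ => gridCell_measurableSet a b (N n) i),
      Finset.sum_congr rfl fun i _ => volume_gridCell hab (N n) i]
    simp only [Finset.sum_const, nsmul_eq_mul, ENNReal.toReal_mul, ENNReal.toReal_natCast]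
    rw [ENNReal.toReal_ofReal]
    exact Finset.prod_nonneg fun j _ =>
      div_nonneg (sub_nonneg.2 (hab j).le) (Nat.cast_nonneg _)
  have hint : interior E =ᵐ[volume] E := interior_ae_eq_of_null_frontier hEf
  have hlim : Tendsto (fun n => volume (A n)) atTop (nhds (volume (interior E))) := by
    refine tendsto_measure_of_ae_tendsto_indicator atTop isOpen_interior.measurableSet hAm
      measurableSet_Icc hIcc (Eventually.of_forall hAIcc) ?_
    have hIco : (Set.univ.pi fun j => Set.Ico (a j) (b j)) =ᵐ[volume] Set.Icc a b :=
      Measure.univ_pi_Ico_ae_eq_Icc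
    have hfr : ∀ᵐ t ∂volume, t ∉ frontier E := measure_eq_zero_iff_ae_notMem.1 hEf
    have hIco' := hIco.mem_iff
    filter_upwards [hfr, hIco'] with t ht htI
    by_cases htE : t ∈ interior E
    · obtain ⟨ε, hε, hball⟩ := Metric.isOpen_iff.1 isOpen_interior t htE
      have hNpos : ∀ᶠ n in atTop, ∀ j, 0 < N n j := by
        rw [eventually_all]
        exact fun j => (hN j).eventually_gt_atTop 0
      filter_upwards [eventually_dist_grid_lt hN hau hε, hNpos] with n hn hNn
      obtain ⟨i, hi⟩ := exists_mem_gridCell hab hNn (htI.2 (hE (interior_subset htE)))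
      refine iff_of_true ?_ htE
      exact Set.mem_iUnion₂.2 ⟨i, Finset.mem_filter.2 ⟨Finset.mem_univ _,
        interior_subset (hball (hn i t hi))⟩, hi⟩
    · have htc : t ∉ closure E := fun h => ht ⟨h, htE⟩
      obtain ⟨ε, hε, hball⟩ := Metric.isOpen_iff.1 isClosed_closure.isOpen_compl t htc
      filter_upwards [eventually_dist_grid_lt hN hau hε] with n hn
      refine iff_of_false (fun h => ?_) htE
      obtain ⟨i, hi, hti⟩ := Set.mem_iUnion₂.1 h
      exact hball (hn i t hti) (subset_closure (Finset.mem_filter.1 hi).2)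
  rw [measure_congr hint] at hlim
  have hEfin : volume E ≠ ⊤ := ne_top_of_le_ne_top hIcc (measure_mono hE)
  refine ((ENNReal.tendsto_toReal hEfin).comp hlim).congr hAv

lemma aemeasurable_of_ae_continuousWithinAt {d : ℕ} {Ω : Set (Fin d → ℝ)}
    (hΩreg : volume (frontier Ω) = 0) {f : (Fin d → ℝ) → ℝ}
    (hfcont : ∀ᵐ x ∂(volume.restrict Ω), ContinuousWithinAt f Ω x) :
    AEMeasurable f (volume.restrict Ω) := by
  have hint : interior Ω =ᵐ[volume] Ω := interior_ae_eq_of_null_frontier hΩreg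
  obtain ⟨Z, hZsub, hZm, hZ⟩ := exists_measurable_superset_of_null (ae_iff.1 hfcont)
  rw [← Measure.restrict_congr_set hint] at hZ ⊢
  have hD : MeasurableSet (interior Ω \ Z) := isOpen_interior.measurableSet.diff hZm
  have heq : (interior Ω \ Z : Set (Fin d → ℝ)) =ᵐ[volume] interior Ω := by
    rw [Measure.restrict_apply hZm, Set.inter_comm] at hZ
    rw [← Set.sdiff_self_inter]
    exact sdiff_null_ae_eq_self hZ
  rw [← Measure.restrict_congr_set heq]
  refine ContinuousOn.aemeasurable (fun t ht => ?_) hD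
  have : ContinuousWithinAt f Ω t := by
    by_contra h
    exact ht.2 (hZsub h)
  exact this.mono (Set.sdiff_subset.trans interior_subset)

lemma frontier_sublevel_subset {X : Type*} [TopologicalSpace X] (Ω : Set X) (f : X → ℝ) (u : ℝ) :
    frontier {x ∈ Ω | f x ≤ u} ⊆
      frontier Ω ∪ {x ∈ Ω | ¬ ContinuousWithinAt f Ω x} ∪ {x ∈ Ω | f x = u} := by
  intro t ht
  by_contra hcon
  simp only [Set.mem_union, Set.mem_ofPred_eq, not_or, not_and, not_not] at hcon
  obtain ⟨⟨h1, h2⟩, h3⟩ := hcon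
  have htc : t ∈ closure Ω := closure_mono (fun _ h => h.1) ht.1
  have hti : t ∈ interior Ω := by
    by_contra h
    exact h1 ⟨htc, h⟩
  have hΩ : Ω ∈ nhds t := mem_interior_iff_mem_nhds.1 hti
  have htΩ := interior_subset hti
  have hc : ContinuousAt f t := (h2 htΩ).continuousAt hΩ
  rcases lt_or_gt_of_ne (h3 htΩ) with h | h
  · refine ht.2 (mem_interior_iff_mem_nhds.2 ?_)
    filter_upwards [hΩ, hc.eventually_lt continuousAt_const h] with z hz hz'
    exact ⟨hz, hz'.le⟩
  · have := mem_closure_iff_frequently.1 ht.1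
    refine this ?_
    filter_upwards [continuousAt_const.eventually_lt hc h] with z hz hz'
    exact absurd hz'.2 (not_le.2 hz)

lemma null_frontier_sublevel {d : ℕ} {Ω : Set (Fin d → ℝ)}
    (hΩreg : volume (frontier Ω) = 0) {f : (Fin d → ℝ) → ℝ}
    (hfcont : ∀ᵐ x ∂(volume.restrict Ω), ContinuousWithinAt f Ω x) {u : ℝ}
    (hu : volume.restrict Ω {x | f x = u} = 0) :
    volume (frontier {x ∈ Ω | f x ≤ u}) = 0 := by
  have hΩm : NullMeasurableSet Ω volume := nullMeasurableSet_of_null_frontier hΩreg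
  refine measure_mono_null (frontier_sublevel_subset Ω f u) ?_
  rw [ae_iff, Measure.restrict_apply₀' hΩm, Set.inter_comm] at hfcont
  rw [Measure.restrict_apply₀' hΩm, Set.inter_comm] at hu
  exact measure_union_null (measure_union_null hΩreg hfcont) hu

/-- The normalized distribution function `u ↦ μ_d{x ∈ Ω : f x ≤ u} / μ_d(Ω)`. -/
noncomputable def distFun {d : ℕ} (Ω : Set (Fin d → ℝ)) (f : (Fin d → ℝ) → ℝ) (u : ℝ) : ℝ :=
  (volume {x ∈ Ω | f x ≤ u} / volume Ω).toReal

section DistFun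

variable {d : ℕ} {Ω : Set (Fin d → ℝ)} {f : (Fin d → ℝ) → ℝ}

lemma volume_sublevel_div_le_one (u : ℝ) : volume {x ∈ Ω | f x ≤ u} / volume Ω ≤ 1 :=
  ENNReal.div_le_of_le_mul (by rw [one_mul]; exact measure_mono fun _ h => h.1)

lemma ofReal_le_iff_le_distFun {y : ℝ} (u : ℝ) :
    ENNReal.ofReal y ≤ volume {x ∈ Ω | f x ≤ u} / volume Ω ↔ y ≤ distFun Ω f u := by
  have h := ne_top_of_le_ne_top ENNReal.one_ne_top (volume_sublevel_div_le_one (Ω := Ω) (f := f) u)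
  exact ENNReal.ofReal_le_iff_le_toReal h

lemma distFun_nonneg (u : ℝ) : 0 ≤ distFun Ω f u := ENNReal.toReal_nonneg

lemma distFun_le_one (u : ℝ) : distFun Ω f u ≤ 1 :=
  ENNReal.toReal_le_of_le_ofReal zero_le_one (by simpa using volume_sublevel_div_le_one u)

lemma distFun_mono : Monotone (distFun Ω f) := by
  intro u v huv
  refine ENNReal.toReal_mono (ne_top_of_le_ne_top ENNReal.one_ne_top
    (volume_sublevel_div_le_one v)) (ENNReal.div_le_div_right (measure_mono ?_) _)
  exact fun _ h => ⟨h.1, h.2.trans huv⟩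

/-- The distribution function is strictly increasing across points of the essential range. -/
lemma distFun_lt_of_mem_essentialRange (hΩpos : 0 < volume Ω) (hΩfin : volume Ω ≠ ⊤)
    (hΩm : NullMeasurableSet Ω volume) (hf : AEMeasurable f (volume.restrict Ω))
    {u z v : ℝ} (hz : z ∈ essentialRange d Ω f) (huz : u < z) (hzv : z < v) :
    distFun Ω f u < distFun Ω f v := by
  have hm : NullMeasurableSet {x ∈ Ω | f x ≤ u} volume := by
    have h1 : NullMeasurableSet {x | f x ≤ u} (volume.restrict Ω) :=
      hf.nullMeasurable measurableSet_Iic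
    rw [nullMeasurableSet_restrict hΩm, Set.inter_comm] at h1
    exact h1
  have hpos := hz (min (z - u) (v - z)) (lt_min (by linarith) (by linarith))
  set B := {x ∈ Ω | |f x - z| < min (z - u) (v - z)}
  have hB : ∀ t ∈ B, u < f t ∧ f t ≤ v := by
    intro t ht
    have h := abs_lt.1 ht.2
    have h1 := min_le_left (z - u) (v - z)
    have h2 := min_le_right (z - u) (v - z)
    constructor <;> linarith [h.1, h.2]
  have hlt : volume {x ∈ Ω | f x ≤ u} < volume {x ∈ Ω | f x ≤ v} := by
    have hfin : volume {x ∈ Ω | f x ≤ u} ≠ ⊤ :=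
      ne_top_of_le_ne_top hΩfin (measure_mono fun _ h => h.1)
    calc volume {x ∈ Ω | f x ≤ u} < volume {x ∈ Ω | f x ≤ u} + volume B :=
          ENNReal.lt_add_right hfin hpos.ne'
      _ = volume ({x ∈ Ω | f x ≤ u} ∪ B) := by
          refine (measure_union₀' hm (Disjoint.aedisjoint ?_)).symm
          exact Set.disjoint_left.2 fun t h h' => absurd h.2 (not_le.2 (hB t h').1)
      _ ≤ volume {x ∈ Ω | f x ≤ v} := by
          refine measure_mono (Set.union_subset (fun t h => ⟨h.1, by linarith [h.2]⟩) ?_)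
          exact fun t h => ⟨h.1, (hB t h).2⟩
  exact (ENNReal.toReal_lt_toReal (ne_top_of_le_ne_top ENNReal.one_ne_top
    (volume_sublevel_div_le_one u)) (ne_top_of_le_ne_top ENNReal.one_ne_top
    (volume_sublevel_div_le_one v))).2 (ENNReal.div_lt_div_right hΩpos.ne' hΩfin hlt)

end DistFun

lemma monotoneRearrangement_eq_sInf_distFun {d : ℕ} (Ω : Set (Fin d → ℝ))
    (f : (Fin d → ℝ) → ℝ) (y : ℝ) :
    monotoneRearrangement d Ω f y = sInf {u : ℝ | y ≤ distFun Ω f u} := by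
  simp only [monotoneRearrangement, ofReal_le_iff_le_distFun]

/-- The extended monotone rearrangement takes values between `m` and `M` and is the generalized
inverse of the distribution function, when the essential range is `[m, M]`. -/
lemma monotoneRearrangementExt_spec {d : ℕ} {Ω : Set (Fin d → ℝ)} {f : (Fin d → ℝ) → ℝ}
    (hΩpos : 0 < volume Ω) (hΩfin : volume Ω ≠ ⊤)
    (hΩm : NullMeasurableSet Ω volume) (hf : AEMeasurable f (volume.restrict Ω))
    {m M : ℝ} (hmM : m ≤ M) (hER : essentialRange d Ω f = Set.Icc m M)
    (hm : ∀ x ∈ Ω, m ≤ f x) (hM : ∀ x ∈ Ω, f x ≤ M) (y : ℝ) :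
    monotoneRearrangementExt d Ω f y ∈ Set.Icc m M ∧
    (∀ w, m ≤ w → w < M → y < distFun Ω f w → monotoneRearrangementExt d Ω f y ≤ w) ∧
    (∀ w, w ≤ M → distFun Ω f w < y → w ≤ monotoneRearrangementExt d Ω f y) ∧
    (∀ w, m ≤ w → w < monotoneRearrangementExt d Ω f y → distFun Ω f w < y) ∧
    (∀ w, w < M → monotoneRearrangementExt d Ω f y < w → y < distFun Ω f w) := by
  have hlt : ∀ u v, m ≤ u → u < v → v ≤ M → distFun Ω f u < distFun Ω f v := by
    intro u v hu huv hv
    obtain ⟨z, h1, h2⟩ := exists_between huv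
    exact distFun_lt_of_mem_essentialRange hΩpos hΩfin hΩm hf
      (by rw [hER]; exact ⟨by linarith, by linarith⟩) h1 h2
  have hone : distFun Ω f M = 1 := by
    have : {x ∈ Ω | f x ≤ M} = Ω := Set.ext fun x => ⟨fun h => h.1, fun h => ⟨h, hM x h⟩⟩
    rw [distFun, this, ENNReal.div_self hΩpos.ne' hΩfin, ENNReal.toReal_one]
  have hzero : ∀ u, u < m → distFun Ω f u = 0 := by
    intro u hu
    have : {x ∈ Ω | f x ≤ u} = ∅ := by
      ext x
      exact iff_of_false (fun h => absurd (hm x h.1) (by linarith [h.2])) (by simp)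
    rw [distFun, this, measure_empty, ENNReal.zero_div, ENNReal.toReal_zero]
  rcases le_or_gt y 0 with hy0 | hy0
  · have hq : monotoneRearrangementExt d Ω f y = m := by
      rw [monotoneRearrangementExt, if_pos hy0, hER, csInf_Icc hmM]
    rw [hq]
    refine ⟨⟨le_rfl, hmM⟩, fun w h1 _ _ => h1, fun w _ h => ?_, fun w h1 h2 => ?_,
      fun w h1 h2 => ?_⟩
    · linarith [distFun_nonneg (Ω := Ω) (f := f) w]
    · linarith
    · have := hlt m w le_rfl h2 h1.le
      linarith [distFun_nonneg (Ω := Ω) (f := f) m]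
  rcases le_or_gt 1 y with hy1 | hy1
  · have hq : monotoneRearrangementExt d Ω f y = M := by
      rw [monotoneRearrangementExt, if_neg hy0.not_ge, if_pos hy1, hER, csSup_Icc hmM]
    rw [hq]
    refine ⟨⟨hmM, le_rfl⟩, fun w _ _ h => ?_, fun w h _ => h, fun w h1 h2 => ?_,
      fun w h1 h2 => ?_⟩
    · linarith [distFun_le_one (Ω := Ω) (f := f) w]
    · linarith [hlt w M h1 h2 le_rfl]
    · linarith
  · have hq : monotoneRearrangementExt d Ω f y = sInf {u : ℝ | y ≤ distFun Ω f u} := by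
      rw [monotoneRearrangementExt, if_neg hy0.not_ge, if_neg hy1.not_ge,
        monotoneRearrangement_eq_sInf_distFun]
    have hlb : ∀ u ∈ {u : ℝ | y ≤ distFun Ω f u}, m ≤ u := by
      intro u hu
      by_contra! h
      have hu' : y ≤ distFun Ω f u := hu
      rw [hzero u h] at hu'
      linarith
    have hbdd : BddBelow {u : ℝ | y ≤ distFun Ω f u} := ⟨m, hlb⟩
    have hMmem : M ∈ {u : ℝ | y ≤ distFun Ω f u} := by
      change y ≤ distFun Ω f M
      rw [hone]; exact hy1.le
    have hne : {u : ℝ | y ≤ distFun Ω f u}.Nonempty := ⟨M, hMmem⟩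
    rw [hq]
    refine ⟨⟨le_csInf hne hlb, csInf_le hbdd hMmem⟩, fun w _ _ h => csInf_le hbdd h.le,
      fun w _ h => le_csInf hne fun u hu => ?_, fun w _ h2 => ?_, fun w h1 h2 => ?_⟩
    · by_contra! huw
      exact absurd (distFun_mono (Ω := Ω) (f := f) huw.le) (not_le.2 (h.trans_le hu))
    · by_contra! hcon
      exact absurd (csInf_le hbdd hcon) (not_le.2 h2)
    · obtain ⟨u, hu, huw⟩ := exists_lt_of_csInf_lt hne h2
      exact lt_of_le_of_lt hu (hlt u w (hlb u hu) huw h1.le)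

/-- The value of a linear spline with increasing nodal values lies between the values at two
consecutive nodes enclosing the argument. -/
lemma exists_node_linearSpline {ω : ℕ} (hω : 1 ≤ ω) {s : ℕ → ℝ}
    (hs : ∀ ℓ ℓ' : ℕ, ℓ ≤ ℓ' → ℓ' ≤ ω → s ℓ ≤ s ℓ') {y : ℝ} (hy : y ∈ Set.Icc (0 : ℝ) 1) :
    ∃ p : ℕ, p + 1 ≤ ω ∧ (p : ℝ) ≤ y * ω ∧ y * ω ≤ p + 1 ∧
      s p ≤ linearSpline ω s y ∧ linearSpline ω s y ≤ s (p + 1) := by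
  have hyω : 0 ≤ y * ω := mul_nonneg hy.1 (Nat.cast_nonneg _)
  have hyω' : y * ω ≤ ω := mul_le_of_le_one_left (Nat.cast_nonneg _) hy.2
  set p := min (⌊y * (ω : ℝ)⌋.toNat) (ω - 1) with hp
  have hpω : p + 1 ≤ ω := by omega
  have h1 : (p : ℝ) ≤ y * ω := by
    refine le_trans ?_ (Nat.floor_le hyω)
    rw [Int.floor_toNat] at hp
    exact_mod_cast (hp ▸ min_le_left _ _ : p ≤ _)
  have h2 : y * ω ≤ p + 1 := by
    rcases min_choice (⌊y * (ω : ℝ)⌋.toNat) (ω - 1) with h | h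
    · rw [hp, h, Int.floor_toNat]
      exact (Nat.lt_floor_add_one _).le
    · have : p + 1 = ω := by omega
      have h3 : (p : ℝ) + 1 = ω := by exact_mod_cast this
      rw [h3]; exact hyω'
  have h3 := hs p (p + 1) (Nat.le_succ p) hpω
  refine ⟨p, hpω, h1, h2, ?_, ?_⟩
  · rw [linearSpline, ← hp]
    nlinarith [mul_nonneg (sub_nonneg.2 h1) (sub_nonneg.2 h3)]
  · rw [linearSpline, ← hp]
    nlinarith [mul_nonneg (sub_nonneg.2 h2) (sub_nonneg.2 h3)]

/-- Uniform convergence of interpolated empirical quantile functions to a generalized inverse `q`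
of the limit `F` of the empirical distribution functions `w ↦ K n w / c n`. -/
theorem tendstoUniformlyOn_linearSpline_quantile {c : ℕ → ℕ} {s : ℕ → ℕ → ℝ} {K : ℕ → ℝ → ℕ}
    {F q : ℝ → ℝ} {m M : ℝ} {G : Set ℝ} (hG : Dense G)
    (hc : Tendsto c atTop atTop)
    (hs : ∀ n, ∀ ℓ ℓ' : ℕ, ℓ ≤ ℓ' → ℓ' ≤ c n - 1 → s n ℓ ≤ s n ℓ')
    (hsb : ∀ n ℓ, ℓ < c n → s n ℓ ∈ Set.Icc m M)
    (hup : ∀ n w ℓ, ℓ < c n → ℓ < K n w → s n ℓ ≤ w)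
    (hlo : ∀ n w ℓ, ℓ < c n → K n w ≤ ℓ → w ≤ s n ℓ)
    (hK : ∀ w ∈ G, Tendsto (fun n => (K n w : ℝ) / c n) atTop (nhds (F w)))
    (hq : ∀ y, q y ∈ Set.Icc m M ∧ (∀ w, m ≤ w → w < M → y < F w → q y ≤ w) ∧
      (∀ w, w ≤ M → F w < y → w ≤ q y) ∧ (∀ w, m ≤ w → w < q y → F w < y) ∧
      (∀ w, w < M → q y < w → y < F w)) :
    TendstoUniformlyOn (fun n => linearSpline (c n - 1) (s n)) q atTop (Set.Icc 0 1) := by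
  rw [← tendstoLocallyUniformlyOn_iff_tendstoUniformlyOn_of_compact isCompact_Icc,
    Metric.tendstoLocallyUniformlyOn_iff]
  intro ε hε y hy
  have hnode : ∀ n, 2 ≤ c n → ∀ z ∈ Set.Icc (0 : ℝ) 1, ∃ p : ℕ, p + 1 < c n ∧
      (p : ℝ) ≤ z * (c n - 1) ∧ z * (c n - 1) ≤ p + 1 ∧
      s n p ≤ linearSpline (c n - 1) (s n) z ∧
      linearSpline (c n - 1) (s n) z ≤ s n (p + 1) := by
    intro n hn z hz
    obtain ⟨p, h1, h2, h3, h4⟩ := exists_node_linearSpline (by omega) (hs n) hz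
    rw [Nat.cast_sub (by omega), Nat.cast_one] at h2 h3
    exact ⟨p, by omega, h2, h3, h4⟩
  have hupper : ∃ t ∈ nhdsWithin y (Set.Icc 0 1), ∀ᶠ n in atTop, ∀ z ∈ t,
      q z < q y + ε / 2 ∧ linearSpline (c n - 1) (s n) z < q y + ε / 2 := by
    by_cases hqM : q y < M
    · obtain ⟨w, hwG, hw1, hw2⟩ := hG.exists_between
        (show q y < min M (q y + ε / 2) from lt_min hqM (by linarith))
      obtain ⟨hwM, hwε⟩ := lt_min_iff.1 hw2
      have hmw : m ≤ w := (hq y).1.1.trans hw1.le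
      obtain ⟨y₀, hy₀, hy₀F⟩ := exists_between ((hq y).2.2.2.2 w hwM hw1)
      obtain ⟨y₁, hy₁, hy₁F⟩ := exists_between hy₀F
      refine ⟨Set.Icc 0 1 ∩ Set.Iio y₀,
        inter_mem_nhdsWithin _ (Iio_mem_nhds hy₀), ?_⟩
      filter_upwards [(hK w hwG).eventually_const_lt hy₁F, hc.eventually_ge_atTop 2,
        (tendsto_natCast_atTop_atTop (R := ℝ).comp hc).eventually_ge_atTop (2 / (y₁ - y₀))]
        with n hn hc2 hcn z hz
      have hcpos : (0 : ℝ) < c n := by exact_mod_cast (by omega : 0 < c n)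
      refine ⟨((hq z).2.1 w hmw hwM (lt_trans hz.2 hy₀F)).trans_lt hwε, ?_⟩
      obtain ⟨p, hp, hp1, -, -, hp2⟩ := hnode n hc2 z hz.1
      refine (hp2.trans (hup n w (p + 1) hp ?_)).trans_lt hwε
      rw [lt_div_iff₀ hcpos] at hn
      have h5 : 2 ≤ c n * (y₁ - y₀) := (div_le_iff₀ (sub_pos.2 hy₁)).1 hcn
      have h6 : z * c n ≤ y₀ * c n := mul_le_mul_of_nonneg_right (le_of_lt hz.2) hcpos.le
      have h7 : ((p + 1 : ℕ) : ℝ) < K n w := by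
        push_cast
        nlinarith [hz.1.1]
      exact_mod_cast h7
    · refine ⟨Set.Icc 0 1, self_mem_nhdsWithin, ?_⟩
      filter_upwards [hc.eventually_ge_atTop 2] with n hc2 z hz
      obtain ⟨p, hp, -, -, -, hp2⟩ := hnode n hc2 z hz
      exact ⟨by linarith [(hq z).1.2], by linarith [(hsb n (p + 1) hp).2]⟩
  have hlower : ∃ t ∈ nhdsWithin y (Set.Icc 0 1), ∀ᶠ n in atTop, ∀ z ∈ t,
      q y - ε / 2 < q z ∧ q y - ε / 2 < linearSpline (c n - 1) (s n) z := by
    by_cases hqm : m < q y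
    · obtain ⟨w, hwG, hw1, hw2⟩ := hG.exists_between
        (show max m (q y - ε / 2) < q y from max_lt hqm (by linarith))
      obtain ⟨hwm, hwε⟩ := max_lt_iff.1 hw1
      have hwM : w ≤ M := hw2.le.trans (hq y).1.2
      obtain ⟨y₀, hy₀F, hy₀⟩ := exists_between ((hq y).2.2.2.1 w hwm.le hw2)
      obtain ⟨y₁, hy₁F, hy₁⟩ := exists_between hy₀F
      refine ⟨Set.Icc 0 1 ∩ Set.Ioi y₀,
        inter_mem_nhdsWithin _ (Ioi_mem_nhds hy₀), ?_⟩
      filter_upwards [(hK w hwG).eventually_lt_const hy₁F, hc.eventually_ge_atTop 2,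
        (tendsto_natCast_atTop_atTop (R := ℝ).comp hc).eventually_ge_atTop (2 / (y₀ - y₁))]
        with n hn hc2 hcn z hz
      have hcpos : (0 : ℝ) < c n := by exact_mod_cast (by omega : 0 < c n)
      refine ⟨hwε.trans_le ((hq z).2.2.1 w hwM (lt_trans hy₀F hz.2)), ?_⟩
      obtain ⟨p, hp, -, hp1, hp2, -⟩ := hnode n hc2 z hz.1
      refine hwε.trans_le ((hlo n w p (by omega) ?_).trans hp2)
      rw [div_lt_iff₀ hcpos] at hn
      have h5 : 2 ≤ c n * (y₀ - y₁) := (div_le_iff₀ (sub_pos.2 hy₁)).1 hcn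
      have h6 : y₀ * c n ≤ z * c n := mul_le_mul_of_nonneg_right (le_of_lt hz.2) hcpos.le
      have h7 : (K n w : ℝ) ≤ p := by nlinarith [hz.1.2]
      exact_mod_cast h7
    · refine ⟨Set.Icc 0 1, self_mem_nhdsWithin, ?_⟩
      filter_upwards [hc.eventually_ge_atTop 2] with n hc2 z hz
      obtain ⟨p, hp, -, -, hp2, -⟩ := hnode n hc2 z hz
      exact ⟨by linarith [(hq z).1.1], by linarith [(hsb n p (by omega)).1]⟩
  obtain ⟨t, ht, hut⟩ := hupper
  obtain ⟨t', ht', hlt'⟩ := hlower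
  refine ⟨t ∩ t', inter_mem ht ht', ?_⟩
  filter_upwards [hut, hlt'] with n h1 h2 z hz
  obtain ⟨h3, h4⟩ := h1 z hz.1
  obtain ⟨h5, h6⟩ := h2 z hz.2
  rw [Real.dist_eq, abs_lt]
  constructor <;> linarith

section SortedSamples

variable {ι : Type*} {c : ℕ} {s : ℕ → ℝ} {S : Finset ι} {g : ι → ℝ}

lemma exists_eq_of_sorted_samples
    (hval : (List.ofFn (fun ℓ : Fin c => s ℓ.1) : Multiset ℝ) = Multiset.map g S.val)
    {ℓ : ℕ} (hℓ : ℓ < c) : ∃ i ∈ S, g i = s ℓ := by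
  have h : s ℓ ∈ (List.ofFn (fun ℓ : Fin c => s ℓ.1) : Multiset ℝ) :=
    Multiset.mem_coe.2 (List.mem_ofFn.2 ⟨⟨ℓ, hℓ⟩, rfl⟩)
  rw [hval] at h
  simpa using h

lemma card_filter_range_eq_of_sorted_samples
    (hval : (List.ofFn (fun ℓ : Fin c => s ℓ.1) : Multiset ℝ) = Multiset.map g S.val) (w : ℝ) :
    ((Finset.range c).filter (fun ℓ => s ℓ ≤ w)).card = (S.filter (fun i => g i ≤ w)).card := by
  have h1 : (List.ofFn (fun ℓ : Fin c => s ℓ.1) : Multiset ℝ) =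
      Multiset.map s (Finset.range c).val := by
    rw [List.ofFn_eq_map, Finset.range_val, Multiset.range, Multiset.map_coe,
      ← List.map_coe_finRange_eq_range, List.map_map]
    rfl
  have h2 := congrArg (Multiset.countP (fun r => r ≤ w)) (h1.symm.trans hval)
  rw [Multiset.countP_map, Multiset.countP_map] at h2
  exact h2

lemma sample_le_of_lt_card (hs : ∀ ℓ ℓ' : ℕ, ℓ ≤ ℓ' → ℓ' ≤ c - 1 → s ℓ ≤ s ℓ')
    (hval : (List.ofFn (fun ℓ : Fin c => s ℓ.1) : Multiset ℝ) = Multiset.map g S.val)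
    {w : ℝ} {ℓ : ℕ} (hK : ℓ < (S.filter (fun i => g i ≤ w)).card) : s ℓ ≤ w := by
  by_contra! hw
  rw [← card_filter_range_eq_of_sorted_samples hval] at hK
  have hsub : (Finset.range c).filter (fun ℓ => s ℓ ≤ w) ⊆ Finset.range ℓ := by
    intro k hk
    rw [Finset.mem_filter, Finset.mem_range] at hk
    rw [Finset.mem_range]
    by_contra! hle
    linarith [hs ℓ k hle (by omega)]
  have := Finset.card_le_card hsub
  rw [Finset.card_range] at this
  omega

lemma le_sample_of_card_le (hs : ∀ ℓ ℓ' : ℕ, ℓ ≤ ℓ' → ℓ' ≤ c - 1 → s ℓ ≤ s ℓ')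
    (hval : (List.ofFn (fun ℓ : Fin c => s ℓ.1) : Multiset ℝ) = Multiset.map g S.val)
    {w : ℝ} {ℓ : ℕ} (hℓ : ℓ < c) (hK : (S.filter (fun i => g i ≤ w)).card ≤ ℓ) : w ≤ s ℓ := by
  by_contra! hw
  rw [← card_filter_range_eq_of_sorted_samples hval] at hK
  have hsub : Finset.range (ℓ + 1) ⊆ (Finset.range c).filter (fun ℓ => s ℓ ≤ w) := by
    intro k hk
    rw [Finset.mem_range] at hk
    rw [Finset.mem_filter, Finset.mem_range]
    exact ⟨by omega, (hs k ℓ (by omega) (by omega)).trans hw.le⟩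
  have := Finset.card_le_card hsub
  rw [Finset.card_range] at this
  omega

end SortedSamples

/-- (Theorem `th:mainEM'`, item 4.) Let `f : Ω ⊂ ℝ^d → ℝ` be bounded and
continuous a.e. on a regular set `Ω` with `μ_d(Ω) > 0` and essential range
`[inf_Ω f, sup_Ω f]`. Take a rectangle `[a,b] ⊇ Ω`, multi-index sizes `𝐧(n) → ∞`, an a.u.
grid `{x_{𝐢,𝐧}}` in `[a,b]`, and for every `n` let `s n 0 ≤ … ≤ s n ω(n)` be the increasing
rearrangement of the samples `f(x_{𝐢,𝐧})` over the indices with `x_{𝐢,𝐧} ∈ Ω`, where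
`ω(n) + 1` is the number of such indices. Then the linear splines interpolating these sorted
samples at equally spaced nodes converge uniformly on `[0,1]` to the extended monotone
rearrangement `f†`. -/
theorem stmt_11
    (d : ℕ) (hd : 0 < d)
    (Ω : Set (Fin d → ℝ))
    (hΩbdd : Bornology.IsBounded Ω)
    (hΩreg : volume (frontier Ω) = 0)
    (hΩpos : 0 < volume Ω)
    (f : (Fin d → ℝ) → ℝ)
    (hfbdd : ∃ C : ℝ, ∀ x ∈ Ω, |f x| ≤ C)
    (hfcont : ∀ᵐ x ∂(volume.restrict Ω), ContinuousWithinAt f Ω x)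
    (hER : essentialRange d Ω f = Set.Icc (sInf (f '' Ω)) (sSup (f '' Ω)))
    (a b : Fin d → ℝ) (hΩab : Ω ⊆ Set.Icc a b)
    (N : ℕ → Fin d → ℕ) (hN : ∀ j, Tendsto (fun n => N n j) atTop atTop)
    (x : ∀ n, (∀ j, Fin (N n j)) → (Fin d → ℝ))
    (hau : Tendsto (fun n => ⨆ i : ∀ j, Fin (N n j), ⨆ j : Fin d,
        |x n i j - (a j + (((i j : ℕ) : ℝ) + 1) * (b j - a j) / (N n j : ℝ))|)
      atTop (nhds 0))
    (s : ℕ → ℕ → ℝ)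
    (hsmono : ∀ n, ∀ ℓ ℓ' : ℕ, ℓ ≤ ℓ' →
      ℓ' ≤ (Finset.univ.filter (fun i => x n i ∈ Ω)).card - 1 → s n ℓ ≤ s n ℓ')
    (hsval : ∀ n,
      (List.ofFn (fun ℓ : Fin ((Finset.univ.filter (fun i => x n i ∈ Ω)).card) => s n ℓ.1)
          : Multiset ℝ)
        = Multiset.map (fun i => f (x n i)) (Finset.univ.filter (fun i => x n i ∈ Ω)).val) :
    TendstoUniformlyOn
      (fun n => linearSpline ((Finset.univ.filter (fun i => x n i ∈ Ω)).card - 1) (s n))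
      (monotoneRearrangementExt d Ω f) atTop (Set.Icc 0 1) := by
  have hΩm : NullMeasurableSet Ω volume := nullMeasurableSet_of_null_frontier hΩreg
  have hΩfin : volume Ω ≠ ⊤ := hΩbdd.measure_lt_top.ne
  have hf : AEMeasurable f (volume.restrict Ω) :=
    aemeasurable_of_ae_continuousWithinAt hΩreg hfcont
  have hab : ∀ j, a j < b j := by
    intro j
    by_contra! h
    refine (hΩpos.trans_le (measure_mono hΩab)).ne' ?_
    rw [Real.volume_Icc_pi]
    exact Finset.prod_eq_zero (Finset.mem_univ j) (ENNReal.ofReal_eq_zero.2 (by linarith))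
  obtain ⟨C, hC⟩ := hfbdd
  have hbelow : BddBelow (f '' Ω) :=
    ⟨-C, by rintro _ ⟨t, ht, rfl⟩; exact (abs_le.1 (hC t ht)).1⟩
  have habove : BddAbove (f '' Ω) :=
    ⟨C, by rintro _ ⟨t, ht, rfl⟩; exact (abs_le.1 (hC t ht)).2⟩
  have hm : ∀ t ∈ Ω, sInf (f '' Ω) ≤ f t := fun t ht => csInf_le hbelow ⟨t, ht, rfl⟩
  have hM : ∀ t ∈ Ω, f t ≤ sSup (f '' Ω) := fun t ht => le_csSup habove ⟨t, ht, rfl⟩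
  have hmM : sInf (f '' Ω) ≤ sSup (f '' Ω) := by
    obtain ⟨t, ht⟩ := nonempty_of_measure_ne_zero hΩpos.ne'
    exact (hm t ht).trans (hM t ht)
  have hG : Dense {w : ℝ | 0 < volume.restrict Ω {t | f t = w}}ᶜ := by
    have : IsFiniteMeasure (volume.restrict Ω) := ⟨by simpa using hΩfin.lt_top⟩
    exact (Measure.countable_meas_level_set_pos₀ hf.nullMeasurable).dense_compl ℝ
  have hNpos : ∀ᶠ n in atTop, ∀ j, 0 < N n j := by
    rw [eventually_all]
    exact fun j => (hN j).eventually_gt_atTop 0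
  have hcell : ∀ᶠ n in atTop, 0 < ∏ j, (b j - a j) / (N n j : ℝ) := by
    filter_upwards [hNpos] with n hn
    exact Finset.prod_pos fun j _ => div_pos (sub_pos.2 (hab j)) (Nat.cast_pos.2 (hn j))
  have hcell0 : Tendsto (fun n => ∏ j, (b j - a j) / (N n j : ℝ)) atTop (nhds 0) := by
    have h : Tendsto (fun n => ∏ j, (b j - a j) / (N n j : ℝ)) atTop
        (nhds (∏ _j : Fin d, (0 : ℝ))) := tendsto_finsetProd _ fun j _ =>
      (tendsto_natCast_atTop_atTop.comp (hN j)).const_div_atTop _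
    simpa [hd.ne'] using h
  have hcΩ := tendsto_card_grid_mul_volume hab hN hau hΩab hΩreg
  have hΩreal : 0 < (volume Ω).toReal := ENNReal.toReal_pos hΩpos.ne' hΩfin
  have hc : Tendsto (fun n => (Finset.univ.filter (fun i => x n i ∈ Ω)).card) atTop atTop := by
    rw [← tendsto_natCast_atTop_iff (R := ℝ)]
    have hinv : Tendsto (fun n => (∏ j, (b j - a j) / (N n j : ℝ))⁻¹) atTop atTop :=
      (tendsto_nhdsWithin_iff.2 ⟨hcell0, hcell⟩).inv_tendsto_nhdsGT_zero
    refine (hcΩ.pos_mul_atTop hΩreal hinv).congr' ?_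
    filter_upwards [hcell] with n hn
    exact mul_inv_cancel_right₀ hn.ne' _
  refine tendstoUniformlyOn_linearSpline_quantile
    (K := fun n w => ((Finset.univ.filter (fun i => x n i ∈ Ω)).filter
      (fun i => f (x n i) ≤ w)).card) hG hc hsmono (fun n ℓ hℓ => ?_)
    (fun n w ℓ _ hK => sample_le_of_lt_card (hsmono n) (hsval n) hK)
    (fun n w ℓ hℓ hK => le_sample_of_card_le (hsmono n) (hsval n) hℓ hK) (fun w hw => ?_)
    (monotoneRearrangementExt_spec hΩpos hΩfin hΩm hf hmM hER hm hM)
  · obtain ⟨i, hi, his⟩ := exists_eq_of_sorted_samples (hsval n) hℓ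
    have hiΩ := (Finset.mem_filter.1 hi).2
    rw [← his]
    exact ⟨hm _ hiΩ, hM _ hiΩ⟩
  · have hw0 : volume.restrict Ω {t | f t = w} = 0 := nonpos_iff_eq_zero.1 (not_lt.1 hw)
    have hKw := tendsto_card_grid_mul_volume hab hN hau (E := {t ∈ Ω | f t ≤ w})
      (fun t ht => hΩab ht.1) (null_frontier_sublevel hΩreg hfcont hw0)
    rw [distFun, ENNReal.toReal_div]
    refine (hKw.div hcΩ hΩreal.ne').congr' ?_
    filter_upwards [hcell] with n hn
    rw [Pi.div_apply, mul_div_mul_right _ _ hn.ne', Finset.filter_filter]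
    congr!
end

section
/- Let x, y ∈ ℝ^m and let σ, τ be permutations of {1,…,m} that sort the components of x and y in increasing order, i.e. x_{σ(1)} ≤ … ≤ x_{σ(m)} and y_{τ(1)} ≤ … ≤ y_{τ(m)}. Then max_{i=1,…,m} |x_{σ(i)} − y_{τ(i)}| ≤ max_{i=1,…,m} |x_i − y_i|. -/
/-- Two permutations of `Fin m` send some `j ≥ i` and some `k ≤ i` to the same element. -/
theorem exists_ge_exists_le_perm_eq {m : ℕ} (σ τ : Equiv.Perm (Fin m)) (i : Fin m) :
    ∃ j, i ≤ j ∧ ∃ k, k ≤ i ∧ σ j = τ k := by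
  have hcard : (Finset.univ : Finset (Fin m)).card <
      ((Finset.Ici i).map σ.toEmbedding).card + ((Finset.Iic i).map τ.toEmbedding).card := by
    simp only [Finset.card_map, Fin.card_Ici, Fin.card_Iic, Finset.card_univ, Fintype.card_fin]
    omega
  obtain ⟨a, ha⟩ := Finset.inter_nonempty_of_card_lt_card_add_card
    (Finset.subset_univ _) (Finset.subset_univ _) hcard
  simp only [Finset.mem_inter, Finset.mem_map, Finset.mem_Ici, Finset.mem_Iic,
    Equiv.coe_toEmbedding] at ha
  obtain ⟨⟨j, hj, hja⟩, k, hk, hka⟩ := ha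
  exact ⟨j, hj, k, hk, hja.trans hka.symm⟩

/-- A pointwise bound `x ≤ y + d` is inherited by the increasing rearrangements. -/
theorem sorted_le_sorted_add {m : ℕ} {x y : Fin m → ℝ} {σ τ : Equiv.Perm (Fin m)}
    (hσ : Monotone fun i => x (σ i)) (hτ : Monotone fun i => y (τ i)) {d : ℝ}
    (h : ∀ i, x i ≤ y i + d) (i : Fin m) : x (σ i) ≤ y (τ i) + d := by
  obtain ⟨j, hj, k, hk, hjk⟩ := exists_ge_exists_le_perm_eq σ τ i
  calc x (σ i) ≤ x (σ j) := hσ hj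
    _ = x (τ k) := by rw [hjk]
    _ ≤ y (τ k) + d := h _
    _ ≤ y (τ i) + d := add_le_add_left (hτ hk) d

/-- If `σ` and `τ` sort the components of `x` and `y` (vectors in `ℝ^m`)
in increasing order, then `max_i |x_{σ(i)} - y_{τ(i)}| ≤ max_i |x_i - y_i|`. -/
theorem stmt_12 (m : ℕ) (x y : Fin m → ℝ) (σ τ : Equiv.Perm (Fin m))
    (hσ : Monotone fun i => x (σ i)) (hτ : Monotone fun i => y (τ i)) :
    (⨆ i : Fin m, |x (σ i) - y (τ i)|) ≤ ⨆ i : Fin m, |x i - y i| := by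
  have hd (i : Fin m) : |x i - y i| ≤ ⨆ i : Fin m, |x i - y i| :=
    le_ciSup (f := fun i => |x i - y i|) (Set.finite_range _).bddAbove i
  refine Real.iSup_le (fun i => ?_) (Real.iSup_nonneg fun i => abs_nonneg _)
  rw [abs_sub_le_iff]
  constructor
  · have := sorted_le_sorted_add hσ hτ (d := ⨆ i : Fin m, |x i - y i|)
      (fun i => by linarith [(abs_sub_le_iff.1 (hd i)).1]) i
    linarith
  · have := sorted_le_sorted_add hτ hσ (d := ⨆ i : Fin m, |x i - y i|)
      (fun i => by linarith [(abs_sub_le_iff.1 (hd i)).2]) i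
    linarith
end

section
/- Let G_n = {x_{i,n}}_{i=1,…,d_n} be an asymptotically uniform grid in [a,b] with d_n → ∞, and let G'_n = {x'_{i,n}}_{i=1,…,d'_n} be a sequence of d'_n real points (regarded as a multiset) such that G'_n ⊂ [a − ε_n, b + ε_n] for some ε_n → 0 and the multiset symmetric difference satisfies |G_n △ G'_n| = o(d_n) as n → ∞. Then d'_n/d_n → 1 as n → ∞, and G'_n becomes an asymptotically uniform grid in [a,b] after rearranging its points in increasing order. -/
open Filter

/-- The cardinality of the symmetric difference of two multisets. -/
noncomputable def symmDiffCard (s t : Multiset ℝ) : ℕ := Multiset.card ((s - t) + (t - s))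

theorem symmDiffCard_comm (s t : Multiset ℝ) : symmDiffCard s t = symmDiffCard t s := by
  rw [symmDiffCard, symmDiffCard, add_comm]

theorem countP_le_countP_add_symmDiffCard (p : ℝ → Prop) [DecidablePred p] (s t : Multiset ℝ) :
    s.countP p ≤ t.countP p + symmDiffCard s t := by
  have h : s ≤ t + (s - t) := le_add_tsub
  have h1 := Multiset.countP_le_of_le p h
  rw [Multiset.countP_add] at h1
  have h2 := Multiset.countP_le_card p (s - t)
  rw [symmDiffCard, Multiset.card_add]
  omega

theorem card_le_card_add_symmDiffCard (s t : Multiset ℝ) :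
    Multiset.card s ≤ Multiset.card t + symmDiffCard s t := by
  simpa using countP_le_countP_add_symmDiffCard (fun _ => True) s t

theorem countP_ofFn {m : ℕ} (p : ℝ → Prop) [DecidablePred p] (x : Fin m → ℝ) :
    (List.ofFn x : Multiset ℝ).countP p = (Finset.univ.filter fun i => p (x i)).card := by
  rw [← Fin.univ_val_map, Multiset.countP_map]
  rfl

theorem coe_ofFn_comp_perm {m : ℕ} (x : Fin m → ℝ) (σ : Equiv.Perm (Fin m)) :
    (List.ofFn (fun i => x (σ i)) : Multiset ℝ) = (List.ofFn x : Multiset ℝ) :=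
  Multiset.coe_eq_coe.2 (σ.ofFn_comp_perm x)

theorem abs_sub_le_symmDiffCard {m k : ℕ} (x : Fin m → ℝ) (y : Fin k → ℝ) :
    |(k : ℝ) - m| ≤ symmDiffCard (List.ofFn x) (List.ofFn y) := by
  have h1 := card_le_card_add_symmDiffCard (List.ofFn x) (List.ofFn y)
  have h2 := card_le_card_add_symmDiffCard (List.ofFn y) (List.ofFn x)
  rw [symmDiffCard_comm] at h2
  simp only [Multiset.coe_card, List.length_ofFn] at h1 h2
  have h1' : (m : ℝ) ≤ k + symmDiffCard (List.ofFn x) (List.ofFn y) := by exact_mod_cast h1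
  have h2' : (k : ℝ) ≤ m + symmDiffCard (List.ofFn x) (List.ofFn y) := by exact_mod_cast h2
  rw [abs_le]
  constructor <;> linarith

/-- Among the first `i + D + 1` entries of `x`, one is at least the `i`-th smallest entry of `y`. -/
theorem exists_le_of_symmDiffCard {m k : ℕ} (x : Fin m → ℝ) (y : Fin k → ℝ) (hy : Monotone y)
    (i : Fin k) (hi : i + symmDiffCard (List.ofFn x) (List.ofFn y) < m) :
    ∃ j : Fin m, (j : ℕ) ≤ i + symmDiffCard (List.ofFn x) (List.ofFn y) ∧ y i ≤ x j := by
  classical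
  by_contra! hcon
  have h := countP_le_countP_add_symmDiffCard (fun s => s < y i) (List.ofFn x) (List.ofFn y)
  rw [countP_ofFn, countP_ofFn] at h
  have h1 : (Finset.univ.filter fun j => y j < y i).card ≤ i := by
    rw [← Fin.card_Iio i]
    refine Finset.card_le_card fun j hj => Finset.mem_Iio.2 ?_
    exact hy.reflect_lt (Finset.mem_filter.1 hj).2
  have h2 : (Finset.Iic (⟨_, hi⟩ : Fin m)).card ≤
      (Finset.univ.filter fun j => x j < y i).card := by
    refine Finset.card_le_card fun j hj => Finset.mem_filter.2 ⟨Finset.mem_univ _, hcon j ?_⟩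
    exact Fin.le_def.1 (Finset.mem_Iic.1 hj)
  rw [Fin.card_Iic] at h2
  dsimp only at h2
  omega

/-- Among the last `k - i + D` entries of `x`, one is at most the `i`-th smallest entry of `y`. -/
theorem exists_ge_of_symmDiffCard {m k : ℕ} (x : Fin m → ℝ) (y : Fin k → ℝ) (hy : Monotone y)
    (i : Fin k) (hi : k + symmDiffCard (List.ofFn x) (List.ofFn y) ≤ m + i) :
    ∃ j : Fin m, m + i ≤ j + k + symmDiffCard (List.ofFn x) (List.ofFn y) ∧ x j ≤ y i := by
  classical
  by_contra! hcon
  have h := countP_le_countP_add_symmDiffCard (fun s => y i < s) (List.ofFn x) (List.ofFn y)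
  rw [countP_ofFn, countP_ofFn] at h
  have hik := i.isLt
  have h1 : (Finset.univ.filter fun j => y i < y j).card ≤ k - 1 - i := by
    rw [← Fin.card_Ioi i]
    refine Finset.card_le_card fun j hj => Finset.mem_Ioi.2 ?_
    exact hy.reflect_lt (Finset.mem_filter.1 hj).2
  have hlt : m + i - k - symmDiffCard (List.ofFn x) (List.ofFn y) < m := by omega
  have h2 : (Finset.Ici (⟨_, hlt⟩ : Fin m)).card ≤
      (Finset.univ.filter fun j => y i < x j).card := by
    refine Finset.card_le_card fun j hj => Finset.mem_filter.2 ⟨Finset.mem_univ _, hcon j ?_⟩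
    have := Fin.le_def.1 (Finset.mem_Ici.1 hj)
    dsimp only at this
    omega
  rw [Fin.card_Ici] at h2
  dsimp only at h2
  omega

/-- Quantitative stability of uniform grids: if `x` is `δ`-close to the uniform grid of `m` points
in `[a, b]`, a monotone `y` with values in `[a - e, b + e]` is close to the uniform grid of `k`
points, with an error controlled by the symmetric difference of `x` and `y`. -/
theorem abs_sub_uniform_le {a b δ e : ℝ} (hab : a ≤ b) {m k : ℕ} (hm : 0 < m)
    (x : Fin m → ℝ) (y : Fin k → ℝ) (hy : Monotone y)
    (hx : ∀ i : Fin m, |x i - (a + (((i : ℕ) : ℝ) + 1) * (b - a) / (m : ℝ))| ≤ δ)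
    (hδ : 0 ≤ δ) (he : ∀ i, y i ∈ Set.Icc (a - e) (b + e)) (i : Fin k) :
    |y i - (a + (((i : ℕ) : ℝ) + 1) * (b - a) / (k : ℝ))| ≤
      3 * (b - a) * ((symmDiffCard (List.ofFn x) (List.ofFn y) : ℝ) / m) + δ + |e| := by
  have hcard := abs_sub_le_symmDiffCard x y
  have hup := exists_le_of_symmDiffCard x y hy i
  have hlo := exists_ge_of_symmDiffCard x y hy i
  generalize symmDiffCard (List.ofFn x) (List.ofFn y) = D at *
  have hm' : (0 : ℝ) < m := by exact_mod_cast hm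
  have hik : ((i : ℕ) : ℝ) + 1 ≤ k := by exact_mod_cast i.isLt
  have hi0 : (0 : ℝ) ≤ ((i : ℕ) : ℝ) := Nat.cast_nonneg _
  have hk' : (0 : ℝ) < k := by linarith
  obtain ⟨h, hh⟩ : ∃ h, h = (b - a) / m := ⟨_, rfl⟩
  have hh0 : 0 ≤ h := hh ▸ div_nonneg (sub_nonneg.2 hab) hm'.le
  have hmh : m * h = b - a := by rw [hh]; field_simp
  have hxh : ∀ j : Fin m, |x j - (a + (((j : ℕ) : ℝ) + 1) * h)| ≤ δ := by
    intro j; rw [hh, ← mul_div_assoc]; exact hx j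
  have hDh : 3 * (b - a) * ((D : ℝ) / m) = 3 * (D * h) := by rw [hh]; ring
  have hDh0 : 0 ≤ (D : ℝ) * h := by positivity
  obtain ⟨hc1, hc2⟩ := abs_le.1 hcard
  have hee := le_abs_self e
  have he0 := abs_nonneg e
  obtain ⟨hy1, hy2⟩ := he i
  have upper : y i ≤ a + ((i : ℕ) + 1 + D) * h + δ + |e| := by
    by_cases hlt : (i : ℕ) + D < m
    · obtain ⟨j, hj, hyx⟩ := hup hlt
      have hj' : ((j : ℕ) : ℝ) ≤ (i : ℕ) + D := by exact_mod_cast hj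
      have := (abs_le.1 (hxh j)).2
      have := mul_le_mul_of_nonneg_right hj' hh0
      linarith
    · have hj' : (m : ℝ) ≤ (i : ℕ) + D := by exact_mod_cast not_lt.1 hlt
      have := mul_le_mul_of_nonneg_right hj' hh0
      linarith
  have lower : a + ((i : ℕ) + 1 - 2 * D) * h - δ - |e| ≤ y i := by
    by_cases hle : k + D ≤ m + (i : ℕ)
    · obtain ⟨j, hj, hyx⟩ := hlo hle
      have hj' : (m : ℝ) + (i : ℕ) ≤ (j : ℕ) + k + D := by exact_mod_cast hj
      have := (abs_le.1 (hxh j)).1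
      have : ((i : ℕ) - 2 * D : ℝ) * h ≤ (j : ℕ) * h :=
        mul_le_mul_of_nonneg_right (by linarith) hh0
      linarith
    · have hj' : (m : ℝ) + (i : ℕ) + 1 ≤ k + D := by exact_mod_cast not_le.1 hle
      have : ((i : ℕ) + 1 - 2 * D : ℝ) * h ≤ 0 :=
        mul_nonpos_of_nonpos_of_nonneg (by linarith) hh0
      linarith
  have mesh : |((i : ℕ) + 1 : ℝ) * (b - a) / k - ((i : ℕ) + 1) * h| ≤ D * h := by
    have heq : ((i : ℕ) + 1 : ℝ) * (b - a) / k - ((i : ℕ) + 1) * h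
        = (((i : ℕ) + 1) / k) * ((m - k) * h) := by
      rw [← hmh]; field_simp
    rw [heq, abs_mul, abs_mul, abs_of_nonneg hh0, abs_of_nonneg (by positivity), abs_sub_comm]
    calc _ ≤ 1 * (D * h) := by
          gcongr
          exact (div_le_one hk').2 hik
      _ = _ := one_mul _
  obtain ⟨hm1, hm2⟩ := abs_le.1 mesh
  rw [hDh, abs_le]
  constructor <;> linarith

/-- If `G_n` is an a.u. grid in `[a,b]` with `d_n → ∞`, and `G'_n` is a
sequence of `d'_n` real points with `G'_n ⊂ [a − ε_n, b + ε_n]` for some `ε_n → 0` and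
`|G_n △ G'_n| = o(d_n)` (multiset symmetric difference), then `d'_n/d_n → 1` and `G'_n`,
once rearranged in increasing order, is an a.u. grid in `[a,b]`. -/
theorem stmt_14 (a b : ℝ) (d d' : ℕ → ℕ) (hd : Tendsto d atTop atTop)
    (x : ∀ n, Fin (d n) → ℝ) (x' : ∀ n, Fin (d' n) → ℝ)
    (hau : Tendsto (fun n => ⨆ i : Fin (d n),
        |x n i - (a + (((i : ℕ) : ℝ) + 1) * (b - a) / (d n : ℝ))|) atTop (nhds 0))
    (ε : ℕ → ℝ) (hε : Tendsto ε atTop (nhds 0))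
    (hx' : ∀ n i, x' n i ∈ Set.Icc (a - ε n) (b + ε n))
    (hsymmdiff : Tendsto (fun n =>
        ((Multiset.card
          (((List.ofFn (x n) : Multiset ℝ) - (List.ofFn (x' n) : Multiset ℝ)) +
           ((List.ofFn (x' n) : Multiset ℝ) - (List.ofFn (x n) : Multiset ℝ))) : ℕ) : ℝ)
        / (d n : ℝ)) atTop (nhds 0)) :
    Tendsto (fun n => (d' n : ℝ) / (d n : ℝ)) atTop (nhds 1) ∧
    ∀ τ : ∀ n, Equiv.Perm (Fin (d' n)), (∀ n, Monotone fun i => x' n (τ n i)) →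
      Tendsto (fun n => ⨆ i : Fin (d' n),
        |x' n (τ n i) - (a + (((i : ℕ) : ℝ) + 1) * (b - a) / (d' n : ℝ))|) atTop (nhds 0) := by
  change Tendsto (fun n => (symmDiffCard (List.ofFn (x n)) (List.ofFn (x' n)) : ℝ) / (d n : ℝ))
    atTop (nhds 0) at hsymmdiff
  have hdpos : ∀ᶠ n in atTop, 0 < d n := hd.eventually_gt_atTop 0
  have hratio : Tendsto (fun n => (d' n : ℝ) / (d n : ℝ)) atTop (nhds 1) := by
    rw [tendsto_iff_dist_tendsto_zero]
    refine squeeze_zero' (.of_forall fun _ => dist_nonneg) ?_ hsymmdiff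
    filter_upwards [hdpos] with n hn
    have hn' : (0 : ℝ) < d n := by exact_mod_cast hn
    rw [Real.dist_eq, div_sub_one hn'.ne', abs_div, abs_of_pos hn']
    gcongr
    exact abs_sub_le_symmDiffCard (x n) (x' n)
  refine ⟨hratio, fun τ hτ => ?_⟩
  have hab : a ≤ b := by
    by_contra! hlt
    obtain ⟨n, hεn, hrn⟩ := ((hε.eventually_lt_const (half_pos (sub_pos.2 hlt))).and
      (hratio.eventually_const_lt one_pos)).exists
    have hpos : 0 < d' n := by
      by_contra h0
      simp [Nat.eq_zero_of_not_pos h0] at hrn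
    obtain ⟨h1, h2⟩ := hx' n ⟨0, hpos⟩
    linarith
  have hbound := ((hsymmdiff.const_mul (3 * (b - a))).add hau).add hε.abs
  simp only [mul_zero, add_zero, abs_zero] at hbound
  refine squeeze_zero' (.of_forall fun n => Real.iSup_nonneg fun _ => abs_nonneg _) ?_ hbound
  filter_upwards [hdpos] with n hn
  have hδ := Real.iSup_nonneg fun i : Fin (d n) =>
    abs_nonneg (x n i - (a + (((i : ℕ) : ℝ) + 1) * (b - a) / (d n : ℝ)))
  refine Real.iSup_le (fun i => ?_) ?_
  · have := abs_sub_uniform_le hab hn (x n) (fun i => x' n (τ n i)) (hτ n)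
      (fun i => le_ciSup (f := fun i : Fin (d n) =>
        |x n i - (a + (((i : ℕ) : ℝ) + 1) * (b - a) / (d n : ℝ))|)
        (Set.finite_range _).bddAbove i) hδ (fun i => hx' n (τ n i)) i
    rwa [coe_ofFn_comp_perm] at this
  · have := sub_nonneg.2 hab
    positivity
end

section
/- Let I be a bounded real interval and let f : I → ℝ be continuous on I with a finite number of local maximum points and a finite number of local minimum points (in the weak sense). Then for every λ ∈ ℝ the preimage f⁻¹(λ) = {x ∈ I : f(x) = λ} is a finite set. -/
/-- A set is finite if any two of its points are strictly separated by a point of a fixed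
finite set. -/
theorem Set.Finite.of_separated {α : Type*} [LinearOrder α] {s t : Set α} (ht : t.Finite)
    (h : ∀ x ∈ s, ∀ y ∈ s, x < y → ∃ z ∈ t, x < z ∧ z < y) : s.Finite := by
  refine Set.Finite.of_injOn (f := fun x => {z ∈ t | z < x}) (t := 𝒫 t)
    (fun x _ z hz => hz.1) ?_ ht.powerset
  have key : ∀ x ∈ s, ∀ y ∈ s, x < y → {z ∈ t | z < x} ≠ {z ∈ t | z < y} := by
    intro x hx y hy hxy heq
    obtain ⟨z, hz, hxz, hzy⟩ := h x hx y hy hxy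
    have hmem : z ∈ {z ∈ t | z < x} := heq ▸ ⟨hz, hzy⟩
    exact lt_asymm hxz hmem.2
  intro x hx y hy hxy
  rcases lt_trichotomy x y with hlt | heq | hlt
  · exact absurd hxy (key x hx y hy hlt)
  · exact heq
  · exact absurd hxy.symm (key y hy x hx hlt)

/-- If `f` is continuous on a bounded real interval `I` with finitely many
(weak) local maximum points and finitely many (weak) local minimum points, then every level
set `f⁻¹(λ) ∩ I` is finite. -/
theorem stmt_16 (I : Set ℝ) (hIbdd : Bornology.IsBounded I) (hIint : I.OrdConnected)
    (f : ℝ → ℝ) (hf : ContinuousOn f I)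
    (hmax : {x ∈ I | IsLocalMaxOn f I x}.Finite)
    (hmin : {x ∈ I | IsLocalMinOn f I x}.Finite) :
    ∀ lam : ℝ, {x ∈ I | f x = lam}.Finite := by
  intro lam
  refine Set.Finite.of_separated (hmax.union hmin) ?_
  rintro x ⟨hxI, hx⟩ y ⟨hyI, hy⟩ hxy
  have hsub : Set.Icc x y ⊆ I := hIint.out hxI hyI
  obtain ⟨z, hz, hext⟩ := exists_isLocalExtr_Ioo hxy (hf.mono hsub) (hx.trans hy.symm)
  have hzI : z ∈ I := hsub (Set.Ioo_subset_Icc_self hz)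
  refine ⟨z, ?_, hz.1, hz.2⟩
  rcases hext with hlmin | hlmax
  · exact Or.inr ⟨hzI, IsLocalMin.on hlmin I⟩
  · exact Or.inl ⟨hzI, IsLocalMax.on hlmax I⟩
end

section
/- Let I be a bounded real interval and let f : I → ℝ have a finite number of local maximum points, a finite number of local minimum points (in the weak sense), and a finite number of discontinuity points. Then for every λ ∈ ℝ the preimage f⁻¹(λ) = {x ∈ I : f(x) = λ} is a finite set. -/
/-- A function on an order-connected set that takes the same value at `a < b` has a discontinuity
or a local extremum in `[a, b]`. -/
theorem exists_mem_Icc_discontinuity_or_isLocalExtrOn {I : Set ℝ} (hI : I.OrdConnected)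
    {f : ℝ → ℝ} {a b : ℝ} (ha : a ∈ I) (hb : b ∈ I) (hab : a < b) (hf : f a = f b) :
    ∃ c ∈ Set.Icc a b, ¬ ContinuousWithinAt f I c ∨ IsLocalExtrOn f I c := by
  by_cases hcont : ∀ c ∈ Set.Icc a b, ContinuousWithinAt f I c
  · obtain ⟨c, hc, hext⟩ := exists_isLocalExtr_Ioo hab
      (fun c hc => (hcont c hc).mono (hI.out ha hb)) hf
    exact ⟨c, Set.Ioo_subset_Icc_self hc, Or.inr (hext.on I)⟩
  · push Not at hcont
    obtain ⟨c, hc, hdisc⟩ := hcont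
    exact ⟨c, hc, Or.inl hdisc⟩

/-- A set is finite if any two of its points are separated, in the weak sense, by a point of a
fixed finite set. -/
theorem Set.Finite.of_exists_mem_Icc {α : Type*} [LinearOrder α] {s t : Set α} (ht : t.Finite)
    (h : ∀ a ∈ s, ∀ b ∈ s, a < b → ∃ c ∈ t, c ∈ Set.Icc a b) : s.Finite := by
  have hlt : ∀ a ∈ s \ t, ∀ b ∈ s \ t, a < b → t ∩ Set.Iio a ≠ t ∩ Set.Iio b := by
    intro a ha b hb hab heq
    obtain ⟨c, hct, hac, hcb⟩ := h a ha.1 b hb.1 hab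
    have hc : c ∈ t ∩ Set.Iio b := ⟨hct, lt_of_le_of_ne hcb fun e => hb.2 (e ▸ hct)⟩
    rw [← heq] at hc
    exact hac.not_gt hc.2
  have hdiff : (s \ t).Finite := by
    refine Set.Finite.of_injOn (f := fun x => t ∩ Set.Iio x) (t := 𝒫 t)
      (fun x _ => Set.inter_subset_left) ?_ ht.finite_subsets
    intro a ha b hb heq
    rcases lt_trichotomy a b with hab | hab | hab
    · exact absurd heq (hlt a ha b hb hab)
    · exact hab
    · exact absurd heq.symm (hlt b hb a ha hab)
  exact (hdiff.union ht).subset fun x hx => by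
    by_cases hxt : x ∈ t
    · exact Or.inr hxt
    · exact Or.inl ⟨hx, hxt⟩

/-- If `f` on a bounded real interval `I` has finitely many (weak) local
maximum points, finitely many (weak) local minimum points, and finitely many discontinuity
points, then every level set `f⁻¹(λ) ∩ I` is finite. -/
theorem stmt_17 (I : Set ℝ) (hIbdd : Bornology.IsBounded I) (hIint : I.OrdConnected)
    (f : ℝ → ℝ)
    (hmax : {x ∈ I | IsLocalMaxOn f I x}.Finite)
    (hmin : {x ∈ I | IsLocalMinOn f I x}.Finite)
    (hdisc : {x ∈ I | ¬ ContinuousWithinAt f I x}.Finite) :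
    ∀ lam : ℝ, {x ∈ I | f x = lam}.Finite := by
  intro lam
  refine Set.Finite.of_exists_mem_Icc ((hmax.union hmin).union hdisc) ?_
  rintro a ⟨ha, hfa⟩ b ⟨hb, hfb⟩ hab
  obtain ⟨c, hc, hbad⟩ :=
    exists_mem_Icc_discontinuity_or_isLocalExtrOn hIint ha hb hab (hfa.trans hfb.symm)
  have hcI : c ∈ I := hIint.out ha hb hc
  refine ⟨c, ?_, hc⟩
  rcases hbad with hd | hmin' | hmax'
  · exact Or.inr ⟨hcI, hd⟩
  · exact Or.inl (Or.inr ⟨hcI, hmin'⟩)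
  · exact Or.inl (Or.inl ⟨hcI, hmax'⟩)
end

section
/- Let X be a finite set, and let A_1,…,A_k and B_1,…,B_k be two partitions of X with |A_i| = |B_i| for every i = 1,…,k. Let G = (V,E) be the directed graph on nodes V = {1,…,k} in which a directed edge (i,j) ∈ E exists if and only if A_i ∩ B_j is nonempty. Then, whenever (i,j) ∈ E, there exists a directed path in G from j to i (i.e. a sequence of nodes i_1,…,i_q with i_1 = j, i_q = i, and (i_a, i_{a+1}) ∈ E for all a = 1,…,q−1; a path from a node to itself of length one is allowed). -/
/-- Let `A_1,…,A_k` and `B_1,…,B_k` be two partitions of a finite set `X`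
with `|A_i| = |B_i|` for every `i`. In the directed graph on `{1,…,k}` with an edge `(i,j)`
iff `A_i ∩ B_j ≠ ∅`, whenever `(i,j)` is an edge there is a directed path from `j` to `i`. -/
theorem stmt_19 {X : Type*} [Fintype X] [DecidableEq X] (k : ℕ)
    (A B : Fin k → Finset X)
    (hAdisj : ∀ i j, i ≠ j → Disjoint (A i) (A j))
    (hBdisj : ∀ i j, i ≠ j → Disjoint (B i) (B j))
    (hAcover : Finset.univ.biUnion A = Finset.univ)
    (hBcover : Finset.univ.biUnion B = Finset.univ)
    (hcard : ∀ i, (A i).card = (B i).card)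
    (E : Fin k → Fin k → Prop)
    (hE : ∀ i j, E i j ↔ (A i ∩ B j).Nonempty) :
    ∀ i j, E i j → Relation.ReflTransGen E j i := by
  classical
  intro i j hij
  let R : Finset (Fin k) := Finset.univ.filter (Relation.ReflTransGen E j)
  have hsub : R.biUnion A ⊆ R.biUnion B := by
    intro x hx
    obtain ⟨a, ha, hxa⟩ := Finset.mem_biUnion.1 hx
    obtain ⟨b, -, hxb⟩ := Finset.mem_biUnion.1 (hBcover ▸ Finset.mem_univ x)
    have hab : E a b := (hE a b).2 ⟨x, Finset.mem_inter.2 ⟨hxa, hxb⟩⟩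
    have hja : Relation.ReflTransGen E j a := (Finset.mem_filter.1 ha).2
    exact Finset.mem_biUnion.2
      ⟨b, Finset.mem_filter.2 ⟨Finset.mem_univ b, hja.tail hab⟩, hxb⟩
  have hcards : (R.biUnion B).card = (R.biUnion A).card := by
    rw [Finset.card_biUnion fun a _ b _ => hAdisj a b,
      Finset.card_biUnion fun a _ b _ => hBdisj a b]
    exact Finset.sum_congr rfl fun a _ => (hcard a).symm
  have heq : R.biUnion A = R.biUnion B := Finset.eq_of_subset_of_card_le hsub hcards.le
  obtain ⟨x, hx⟩ := (hE i j).1 hij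
  obtain ⟨hxi, hxj⟩ := Finset.mem_inter.1 hx
  have hxB : x ∈ R.biUnion B :=
    Finset.mem_biUnion.2 ⟨j, Finset.mem_filter.2 ⟨Finset.mem_univ j, .refl⟩, hxj⟩
  obtain ⟨a, ha, hxa⟩ := Finset.mem_biUnion.1 (heq ▸ hxB)
  have hai : a = i := by
    by_contra hne
    exact Finset.disjoint_left.1 (hAdisj a i hne) hxa hxi
  exact hai ▸ (Finset.mem_filter.1 ha).2
end
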